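/- arXiv:0910.3344 — 3 statements merged into one kernel-verified Lean document; each statement's English description precedes it below -/
import Mathlib

section
/- For every μ ∈ ℂ, every real σ > |Re μ| and every y > 0, the inverse Mellin (Barnes-type) integral (1/(2π))·∫_{−∞}^{∞} Γ((σ+it+μ)/2)·Γ((σ+it−μ)/2)·(πy)^{−σ−it} dt converges absolutely and equals 4·K_μ(2πy). -/
open MeasureTheory Real Set

/-- The modified Bessel function of the second kind `K_μ(x)`, defined for `x > 0` by
`K_μ(x) = ∫₀^∞ exp(−x·cosh t)·cosh(μt) dt`. -/
noncomputable def besselK (μ : ℂ) (x : ℝ) : ℂ :=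
  ∫ t in Ioi (0 : ℝ), Complex.exp (-(x : ℂ) * Real.cosh t) * Complex.cosh (μ * t)

/-- On the right half-plane, the Gamma function is dominated by its value at the real part. -/
lemma norm_Gamma_le_Gamma_re {s : ℂ} (hs : 0 < s.re) :
    ‖Complex.Gamma s‖ ≤ Real.Gamma s.re := by
  rw [Complex.Gamma_eq_integral hs, Complex.GammaIntegral, Real.Gamma_eq_integral hs]
  refine (norm_integral_le_integral_norm _).trans_eq ?_
  refine setIntegral_congr_fun measurableSet_Ioi fun x hx => ?_
  simp [Complex.norm_cpow_eq_rpow_re_of_pos hx, Complex.norm_exp]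

lemma continuous_Gamma_verticalLine {c : ℂ} (hc : 0 < c.re) :
    Continuous fun t : ℝ => Complex.Gamma (c + t * Complex.I) := by
  rw [continuous_iff_continuousAt]
  intro t
  refine ContinuousAt.comp (f := fun t : ℝ => c + t * Complex.I) (g := Complex.Gamma)
    (Complex.differentiableAt_Gamma _ fun m h => ?_).continuousAt (by fun_prop)
  have := congrArg Complex.re h
  simp at this
  linarith [(Nat.cast_nonneg m : (0 : ℝ) ≤ m)]

lemma integrable_Gamma_verticalLine {c : ℂ} (hc : 0 < c.re) :
    Integrable fun t : ℝ => Complex.Gamma (c + t * Complex.I) := by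
  set m := min (c.re ^ 2) 1
  have hm : 0 < m := lt_min (by positivity) one_pos
  refine ((integrable_inv_one_add_sq.comp_add_right c.im).const_mul
    (Real.Gamma (c.re + 2) / m)).mono'
    (continuous_Gamma_verticalLine hc).aestronglyMeasurable (Filter.Eventually.of_forall fun t => ?_)
  set s := c + t * Complex.I with hsdef
  have hre : s.re = c.re := by simp [hsdef]
  have him : s.im = t + c.im := by simp [hsdef, add_comm]
  have hs0 : s ≠ 0 := fun h => by simp [← hre, h] at hc
  have hs1 : s + 1 ≠ 0 := fun h => by
    have := congrArg Complex.re h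
    simp [hre] at this
    linarith
  have hrec : Complex.Gamma (s + 2) = (s + 1) * (s * Complex.Gamma s) := by
    rw [← Complex.Gamma_add_one s hs0, ← Complex.Gamma_add_one _ hs1]
    ring_nf
  have hbound : ‖Complex.Gamma (s + 2)‖ ≤ Real.Gamma (c.re + 2) := by
    have h := norm_Gamma_le_Gamma_re (s := s + 2) (by simp [hre]; linarith)
    simpa [hre] using h
  have hmono : ‖s‖ ≤ ‖s + 1‖ := by
    rw [← sq_le_sq₀ (norm_nonneg _) (norm_nonneg _), Complex.sq_norm, Complex.sq_norm,
      Complex.normSq_apply, Complex.normSq_apply]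
    simp [hre]
    nlinarith
  have hlower : m * (1 + (t + c.im) ^ 2) ≤ ‖s + 1‖ * ‖s‖ := by
    have h1 : m ≤ c.re ^ 2 := min_le_left _ _
    have h2 : m ≤ 1 := min_le_right _ _
    have h3 : ‖s‖ ^ 2 = c.re ^ 2 + (t + c.im) ^ 2 := by
      rw [Complex.sq_norm, Complex.normSq_apply, hre, him]; ring
    nlinarith [norm_nonneg s, sq_nonneg (t + c.im)]
  rw [← div_eq_mul_inv, div_div, le_div_iff₀ (by positivity)]
  calc ‖Complex.Gamma s‖ * (m * (1 + (t + c.im) ^ 2))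
      ≤ ‖Complex.Gamma s‖ * (‖s + 1‖ * ‖s‖) := by gcongr
    _ = ‖Complex.Gamma (s + 2)‖ := by rw [hrec, norm_mul, norm_mul]; ring
    _ ≤ _ := hbound

/-- The Cahen–Mellin integral. -/
lemma integral_cpow_mul_Gamma_verticalLine {c : ℂ} (hc : 0 < c.re) {z : ℝ} (hz : 0 < z) :
    ∫ t : ℝ, (z : ℂ) ^ (-(t * Complex.I)) * Complex.Gamma (c + t * Complex.I)
      = 2 * π * ((z : ℂ) ^ c * Complex.exp (-z)) := by
  set f : ℝ → ℂ := fun x => (x : ℂ) ^ (c.im * Complex.I) • Complex.exp (-x) with hf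
  have hline (t : ℝ) : ((c.re : ℂ) + t * Complex.I) + c.im * Complex.I = c + t * Complex.I := by
    conv_rhs => rw [← Complex.re_add_im c]
    ring
  have hmellin (t : ℝ) : mellin f (c.re + t * Complex.I) = Complex.Gamma (c + t * Complex.I) := by
    rw [hf, mellin_cpow_smul, hline, Complex.Gamma_eq_integral (by simpa using hc),
      Complex.GammaIntegral_eq_mellin]
    simp [mellin]
  have hconv : MellinConvergent f c.re := by
    rw [hf, MellinConvergent.cpow_smul, Complex.re_add_im]
    refine (Complex.GammaIntegral_convergent hc).congr_fun (fun x _ => ?_) measurableSet_Ioi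
    simp [mul_comm]
  have hvert : Complex.VerticalIntegrable (mellin f) c.re := by
    simpa only [Complex.VerticalIntegrable, hmellin] using integrable_Gamma_verticalLine hc
  have hcont : ContinuousAt f z := by
    have hpow : ContinuousAt (fun x : ℝ => (x : ℂ) ^ (c.im * Complex.I)) z :=
      ContinuousAt.comp (f := fun x : ℝ => (x : ℂ))
        (continuousAt_cpow_const (Complex.ofReal_mem_slitPlane.2 hz))
        Complex.continuous_ofReal.continuousAt
    have hexp : Continuous fun x : ℝ => Complex.exp (-x) := by fun_prop
    exact hpow.smul hexp.continuousAt
  have hz0 : (z : ℂ) ≠ 0 := Complex.ofReal_ne_zero.2 hz.ne'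
  have h := mellinInv_mellin_eq c.re f hz hconv hvert hcont
  simp only [mellinInv, hmellin, neg_add, Complex.cpow_add _ _ hz0, smul_eq_mul, mul_assoc,
    integral_const_mul] at h
  rw [Complex.cpow_neg, Complex.real_smul] at h
  have hzc : (z : ℂ) ^ (c.re : ℂ) ≠ 0 := by simp [Complex.cpow_eq_zero_iff, hz0]
  have hsplit : (z : ℂ) ^ c = (z : ℂ) ^ (c.re : ℂ) * (z : ℂ) ^ (c.im * Complex.I) := by
    rw [← Complex.cpow_add _ _ hz0, Complex.re_add_im]
  rw [hsplit]
  simp only [hf, smul_eq_mul] at h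
  rw [mul_assoc ((z : ℂ) ^ (c.re : ℂ)), ← h]
  push_cast
  generalize ∫ t : ℝ, (z : ℂ) ^ (-(t * Complex.I)) * Complex.Gamma (c + t * Complex.I) = J
  field_simp

lemma norm_cpow_mul_I {x : ℝ} (hx : 0 < x) (t : ℝ) : ‖(x : ℂ) ^ (t * Complex.I)‖ = 1 := by
  simp [Complex.norm_cpow_eq_rpow_re_of_pos hx]

lemma integrable_Gamma_mul_Gamma_verticalLine {a b : ℂ} (ha : 0 < a.re) (hb : 0 < b.re) {w : ℝ}
    (hw : 0 < w) :
    Integrable fun t : ℝ => Complex.Gamma (a + t * Complex.I) * Complex.Gamma (b + t * Complex.I)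
      * (w : ℂ) ^ (-(t * Complex.I)) := by
  have hw0 : (w : ℂ) ≠ 0 := Complex.ofReal_ne_zero.2 hw.ne'
  refine ((integrable_Gamma_verticalLine hb).bdd_mul (c := Real.Gamma a.re)
    (continuous_Gamma_verticalLine ha).aestronglyMeasurable
    (Filter.Eventually.of_forall fun t => ?_)).mul_bdd (c := 1) ?_
    (Filter.Eventually.of_forall fun t => ?_)
  · simpa using norm_Gamma_le_Gamma_re (s := a + t * Complex.I) (by simpa using ha)
  · refine Continuous.aestronglyMeasurable ?_
    exact Continuous.const_cpow (by fun_prop) (Or.inl hw0)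
  · have := norm_cpow_mul_I hw (-t)
    push_cast at this
    rw [← neg_mul, this]

lemma integral_Gamma_mul_Gamma_verticalLine {a b : ℂ} (ha : 0 < a.re) (hb : 0 < b.re) {w : ℝ}
    (hw : 0 < w) :
    ∫ t : ℝ, Complex.Gamma (a + t * Complex.I) * Complex.Gamma (b + t * Complex.I)
      * (w : ℂ) ^ (-(t * Complex.I))
    = 2 * π * ∫ u in Ioi (0 : ℝ), Complex.exp (-u) * (u : ℂ) ^ (a - 1)
        * (((w / u : ℝ) : ℂ) ^ b * Complex.exp (-(w / u : ℝ))) := by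
  have hw0 : (w : ℂ) ≠ 0 := Complex.ofReal_ne_zero.2 hw.ne'
  have hu0 {u : ℝ} (hu : u ∈ Ioi (0 : ℝ)) : (u : ℂ) ≠ 0 :=
    Complex.ofReal_ne_zero.2 (ne_of_gt hu)
  set g : ℝ → ℂ := fun t => (w : ℂ) ^ (-(t * Complex.I)) * Complex.Gamma (b + t * Complex.I)
  set h : ℝ → ℂ := fun u => Complex.exp (-u) * (u : ℂ) ^ (a - 1)
  have hg : Integrable g := by
    refine (integrable_Gamma_verticalLine hb).bdd_mul (c := 1) ?_
      (Filter.Eventually.of_forall fun t => ?_)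
    · exact (Continuous.const_cpow (by fun_prop) (Or.inl hw0)).aestronglyMeasurable
    · have := norm_cpow_mul_I hw (-t)
      push_cast at this
      rw [← neg_mul, this]
  have hh : Integrable h (volume.restrict (Ioi 0)) := by
    refine (Complex.GammaIntegral_convergent ha).congr_fun (fun x _ => ?_) measurableSet_Ioi
    simp [h]
  have hprod : Integrable (Function.uncurry fun (t u : ℝ) =>
      (u : ℂ) ^ (t * Complex.I) * (g t * h u)) (volume.prod (volume.restrict (Ioi 0))) := by
    refine (hg.mul_prod hh).bdd_mul (c := 1) ?_ ?_
    · refine Measurable.aestronglyMeasurable ?_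
      fun_prop
    · have hpos : ∀ᵐ p ∂((volume : Measure ℝ).prod (volume.restrict (Ioi (0 : ℝ)))),
          p.2 ∈ Ioi (0 : ℝ) :=
        Measure.quasiMeasurePreserving_snd.ae (ae_restrict_mem measurableSet_Ioi)
      filter_upwards [hpos] with p hp
      rw [norm_cpow_mul_I hp]
  calc ∫ t : ℝ, Complex.Gamma (a + t * Complex.I) * Complex.Gamma (b + t * Complex.I)
        * (w : ℂ) ^ (-(t * Complex.I))
      = ∫ t : ℝ, ∫ u in Ioi (0 : ℝ), (u : ℂ) ^ (t * Complex.I) * (g t * h u) := by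
        refine integral_congr_ae (Filter.Eventually.of_forall fun t => ?_)
        simp only
        rw [Complex.Gamma_eq_integral (s := a + t * Complex.I) (by simpa using ha),
          Complex.GammaIntegral, mul_assoc, mul_comm, ← integral_const_mul]
        refine setIntegral_congr_fun measurableSet_Ioi fun u hu => ?_
        simp only [g, h]
        rw [show a + t * Complex.I - 1 = t * Complex.I + (a - 1) by ring,
          Complex.cpow_add _ _ (hu0 hu)]
        push_cast
        ring
    _ = ∫ u in Ioi (0 : ℝ), ∫ t : ℝ, (u : ℂ) ^ (t * Complex.I) * (g t * h u) :=
        integral_integral_swap hprod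
    _ = _ := by
        rw [← integral_const_mul]
        refine setIntegral_congr_fun measurableSet_Ioi fun u hu => ?_
        rw [show 2 * (π : ℂ) * (Complex.exp (-u) * (u : ℂ) ^ (a - 1)
            * (((w / u : ℝ) : ℂ) ^ b * Complex.exp (-(w / u : ℝ))))
          = h u * (2 * π * (((w / u : ℝ) : ℂ) ^ b * Complex.exp (-(w / u : ℝ)))) by
            simp only [h]; ring,
          ← integral_cpow_mul_Gamma_verticalLine hb (div_pos hw hu), ← integral_const_mul]
        refine integral_congr_ae (Filter.Eventually.of_forall fun t => ?_)
        simp only [g]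
        have hdiv : ((w / u : ℝ) : ℂ) ^ (-(t * Complex.I))
            = (w : ℂ) ^ (-(t * Complex.I)) * (u : ℂ) ^ (t * Complex.I) := by
          rw [div_eq_mul_inv, Complex.ofReal_mul,
            Complex.mul_cpow_ofReal_nonneg hw.le (inv_nonneg.2 (le_of_lt hu)), Complex.ofReal_inv,
            Complex.inv_cpow _ _ (by
              rw [Complex.arg_ofReal_of_nonneg (le_of_lt hu)]; exact pi_ne_zero.symm),
            Complex.cpow_neg (u : ℂ), inv_inv]
        rw [hdiv]
        ring

lemma integrable_exp_neg_mul_cosh_mul_exp (ν : ℂ) {x : ℝ} (hx : 0 < x) :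
    Integrable fun t : ℝ => Complex.exp (-(x : ℂ) * Real.cosh t) * Complex.exp (ν * t) := by
  have hgauss := integrable_cexp_quadratic (b := (x / 4 : ℝ))
    (by simpa using hx) (ν.re : ℂ) 0
  refine hgauss.norm.mono' (by fun_prop) (Filter.Eventually.of_forall fun t => ?_)
  rw [← Complex.exp_add, Complex.norm_exp, Complex.norm_exp]
  refine Real.exp_le_exp.2 ?_
  have hcosh : t ^ 2 / 4 ≤ Real.cosh t := by
    have hquad := Real.quadratic_le_exp_of_nonneg (abs_nonneg t)
    rw [← Real.cosh_abs, Real.cosh_eq]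
    linarith [sq_abs t, abs_nonneg t, Real.exp_pos (-|t|)]
  simp [-Complex.ofReal_cosh, pow_two]
  nlinarith

lemma integral_exp_neg_mul_cosh_mul_exp (ν : ℂ) {x : ℝ} (hx : 0 < x) :
    ∫ t : ℝ, Complex.exp (-(x : ℂ) * Real.cosh t) * Complex.exp (ν * t) = 2 * besselK ν x := by
  have hpos := integrable_exp_neg_mul_cosh_mul_exp ν hx
  have hneg := integrable_exp_neg_mul_cosh_mul_exp (-ν) hx
  rw [← intervalIntegral.integral_Iic_add_Ioi hpos.integrableOn hpos.integrableOn (b := 0),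
    ← neg_zero, ← integral_comp_neg_Ioi, neg_zero]
  simp only [Real.cosh_neg, Complex.ofReal_neg, mul_neg, ← neg_mul ν]
  rw [← integral_add hneg.integrableOn hpos.integrableOn, besselK, ← integral_const_mul]
  refine setIntegral_congr_fun measurableSet_Ioi fun t _ => ?_
  simp only [Complex.cosh, neg_mul ν]
  ring

lemma integral_Ioi_eq_besselK (a b : ℂ) {X : ℝ} (hX : 0 < X) :
    ∫ u in Ioi (0 : ℝ), Complex.exp (-u) * (u : ℂ) ^ (a - 1)
        * (((X ^ 2 / u : ℝ) : ℂ) ^ b * Complex.exp (-(X ^ 2 / u : ℝ)))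
      = (X : ℂ) ^ (a + b) * (2 * besselK (a - b) (2 * X)) := by
  have himage : (fun t : ℝ => X * Real.exp t) '' univ = Ioi 0 := by
    ext u
    simp only [image_univ, mem_range, mem_Ioi]
    refine ⟨fun ⟨t, ht⟩ => ht ▸ by positivity, fun hu => ⟨Real.log (u / X), ?_⟩⟩
    rw [Real.exp_log (div_pos hu hX)]
    field_simp
  have hinj : InjOn (fun t : ℝ => X * Real.exp t) univ := fun s _ t _ h =>
    Real.exp_injective (mul_left_cancel₀ hX.ne' h)
  have hX0 : (X : ℂ) ≠ 0 := Complex.ofReal_ne_zero.2 hX.ne'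
  rw [← himage, integral_image_eq_integral_abs_deriv_smul MeasurableSet.univ
    (fun t _ => ((Real.hasDerivAt_exp t).const_mul X).hasDerivWithinAt) hinj,
    setIntegral_univ, ← integral_exp_neg_mul_cosh_mul_exp (a - b) (by positivity),
    ← integral_const_mul]
  refine integral_congr_ae (Filter.Eventually.of_forall fun t => ?_)
  have hdiv : X ^ 2 / (X * Real.exp t) = X * Real.exp (-t) := by
    rw [Real.exp_neg]
    field_simp
  have hpow (r : ℝ) (c : ℂ) :
      ((X * Real.exp r : ℝ) : ℂ) ^ c = (X : ℂ) ^ c * Complex.exp (r * c) := by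
    rw [Complex.ofReal_mul, Complex.mul_cpow_ofReal_nonneg hX.le (Real.exp_pos r).le,
      Complex.cpow_def_of_ne_zero (Complex.ofReal_ne_zero.2 (Real.exp_pos r).ne'),
      ← Complex.ofReal_log (Real.exp_pos r).le, Real.log_exp]
  simp only [hdiv, hpow]
  rw [abs_of_pos (by positivity), Complex.real_smul, Complex.cpow_sub _ _ hX0,
    Complex.cpow_add _ _ hX0, Complex.cpow_one]
  have hexp : Complex.exp (-(2 * X : ℝ) * Real.cosh t) * Complex.exp ((a - b) * t)
      = Complex.exp t * Complex.exp (-(X * Real.exp t : ℝ)) * Complex.exp (t * (a - 1))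
        * Complex.exp ((-t : ℝ) * b) * Complex.exp (-(X * Real.exp (-t) : ℝ)) := by
    simp only [← Complex.exp_add, Real.cosh_eq]
    congr 1
    push_cast
    ring
  rw [hexp]
  push_cast
  field_simp

/-- For `σ > |Re μ|` and `y > 0`, the Barnes-type integral
`(1/(2π))·∫_{−∞}^{∞} Γ((σ+it+μ)/2)·Γ((σ+it−μ)/2)·(πy)^{−σ−it} dt` converges absolutely
and equals `4·K_μ(2πy)`. -/
theorem besselK_inverse_mellin (μ : ℂ) (σ : ℝ) (hσ : σ > |μ.re|) (y : ℝ) (hy : 0 < y) :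
    Integrable (fun t : ℝ =>
      Complex.Gamma (((σ : ℂ) + Complex.I * t + μ) / 2)
        * Complex.Gamma (((σ : ℂ) + Complex.I * t - μ) / 2)
        * ((π * y : ℝ) : ℂ) ^ (-(σ : ℂ) - Complex.I * t)) ∧
    (1 / (2 * π)) * ∫ t : ℝ,
        Complex.Gamma (((σ : ℂ) + Complex.I * t + μ) / 2)
          * Complex.Gamma (((σ : ℂ) + Complex.I * t - μ) / 2)
          * ((π * y : ℝ) : ℂ) ^ (-(σ : ℂ) - Complex.I * t)
      = 4 * besselK μ (2 * π * y) := by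
  obtain ⟨hlo, hhi⟩ := abs_lt.1 hσ
  have ha : 0 < ((σ + μ) / 2).re := by simp; linarith
  have hb : 0 < ((σ - μ) / 2).re := by simp; linarith
  have hX : 0 < π * y := by positivity
  set X := π * y with hXdef
  have hX0 : (X : ℂ) ≠ 0 := Complex.ofReal_ne_zero.2 hX.ne'
  set G : ℝ → ℂ := fun t => Complex.Gamma ((σ + μ) / 2 + t * Complex.I)
    * Complex.Gamma ((σ - μ) / 2 + t * Complex.I) * ((X ^ 2 : ℝ) : ℂ) ^ (-(t * Complex.I)) with hG
  have hGint : Integrable G := integrable_Gamma_mul_Gamma_verticalLine ha hb (by positivity)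
  have hcongr : (fun t : ℝ => Complex.Gamma (((σ : ℂ) + Complex.I * t + μ) / 2)
        * Complex.Gamma (((σ : ℂ) + Complex.I * t - μ) / 2)
        * (X : ℂ) ^ (-(σ : ℂ) - Complex.I * t))
      = fun t : ℝ => (X : ℂ) ^ (-(σ : ℂ)) * G (2⁻¹ * t) := by
    ext t
    have hpow : ((X ^ 2 : ℝ) : ℂ) ^ (-((2⁻¹ * t : ℝ) * Complex.I))
        = (X : ℂ) ^ (-(Complex.I * t)) := by
      rw [pow_two, Complex.ofReal_mul, Complex.mul_cpow_ofReal_nonneg hX.le hX.le,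
        ← Complex.cpow_add _ _ hX0]
      congr 1
      push_cast
      ring
    rw [hG]
    simp only
    rw [hpow, sub_eq_add_neg (-(σ : ℂ)), Complex.cpow_add _ _ hX0,
      show ((σ : ℂ) + Complex.I * t + μ) / 2 = (σ + μ) / 2 + (2⁻¹ * t : ℝ) * Complex.I by
        push_cast; ring,
      show ((σ : ℂ) + Complex.I * t - μ) / 2 = (σ - μ) / 2 + (2⁻¹ * t : ℝ) * Complex.I by
        push_cast; ring]
    ring
  rw [hcongr]
  refine ⟨(hGint.comp_mul_left' (by norm_num)).const_mul _, ?_⟩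
  have hXσ : (X : ℂ) ^ (σ : ℂ) ≠ 0 := by simp [Complex.cpow_eq_zero_iff, hX0]
  rw [integral_const_mul, Measure.integral_comp_mul_left,
    integral_Gamma_mul_Gamma_verticalLine ha hb (by positivity), integral_Ioi_eq_besselK _ _ hX,
    show ((σ : ℂ) + μ) / 2 + (σ - μ) / 2 = σ by ring,
    show ((σ : ℂ) + μ) / 2 - (σ - μ) / 2 = μ by ring, Complex.cpow_neg, hXdef, ← mul_assoc 2 π y]
  rw [← hXdef, inv_inv, abs_of_pos two_pos, Complex.real_smul]
  push_cast
  field_simp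
  ring
end

section
/- Let α, β, γ ∈ ℂ with α + β + γ = 0 and Re α = Re β = Re γ = 0, and let w₁, w₂ > 0 be real. Then the double Mellin transform of Jacquet's Whittaker function, ∫₀^∞ ∫₀^∞ W(y₁,y₂)·y₁^{w₁−1}·y₂^{w₂−1} dy₁ dy₂, converges absolutely and equals π^{−w₁−w₂} · Γ((1+w₂−α)/2)·Γ((1+w₂−β)/2)·Γ((1+w₂−γ)/2)·Γ((1+w₁+α)/2)·Γ((1+w₁+β)/2)·Γ((1+w₁+γ)/2) / Γ((2+w₁+w₂)/2). -/
open MeasureTheory Real Set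

/-- Jacquet's Whittaker function for `SL(3,ℤ)`, defined for `y₁, y₂ > 0` by Stade's formula
`W(y₁,y₂) = 16·(πy₁)^{1−γ/2}·(πy₂)^{1+γ/2} ∫₀^∞ K_{(α−β)/2}(2πy₁√(1+u))·
K_{(α−β)/2}(2πy₂√(1+1/u))·u^{−3γ/4−1} du`. -/
noncomputable def jacquetW (α β γ : ℂ) (y₁ y₂ : ℝ) : ℂ :=
  16 * ((π * y₁ : ℝ) : ℂ) ^ (1 - γ / 2) * ((π * y₂ : ℝ) : ℂ) ^ (1 + γ / 2) *
    ∫ u in Ioi (0 : ℝ),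
      besselK ((α - β) / 2) (2 * π * y₁ * Real.sqrt (1 + u))
        * besselK ((α - β) / 2) (2 * π * y₂ * Real.sqrt (1 + u⁻¹))
        * (u : ℂ) ^ (-(3 * γ) / 4 - 1)


/-- Fubini for a dilated Mellin kernel: integrating `x ^ (s - 1) * f (x * g t) * h t` over
`x > 0` first produces the Mellin transform of `f` times the integral of `h * g ^ (-s)`. -/
theorem HasMellin.integrable_prod_comp_mul {X : Type*} [MeasurableSpace X] {ν : Measure X}
    [SFinite ν] {f : ℝ → ℂ} {s m : ℂ} (hf : HasMellin f s m) (hfm : Measurable f)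
    {g : X → ℝ} {h : X → ℂ} (hg : Measurable g) (hg0 : ∀ᵐ t ∂ν, 0 < g t)
    (hh : AEStronglyMeasurable h ν) (hi : Integrable (fun t => h t * (g t : ℂ) ^ (-s)) ν) :
    Integrable (fun p : ℝ × X => (p.1 : ℂ) ^ (s - 1) * f (p.1 * g p.2) * h p.2)
        ((volume.restrict (Ioi 0)).prod ν) ∧
      ∫ p : ℝ × X, (p.1 : ℂ) ^ (s - 1) * f (p.1 * g p.2) * h p.2 ∂((volume.restrict (Ioi 0)).prod ν)
        = m * ∫ t, h t * (g t : ℂ) ^ (-s) ∂ν := by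
  have hmeas : AEStronglyMeasurable
      (fun p : ℝ × X => (p.1 : ℂ) ^ (s - 1) * f (p.1 * g p.2) * h p.2)
      ((volume.restrict (Ioi 0)).prod ν) := by
    refine AEStronglyMeasurable.mul (Measurable.aestronglyMeasurable ?_) hh.comp_snd
    fun_prop
  have hfc : ∀ {c : ℝ}, 0 < c →
      IntegrableOn (fun x : ℝ => (x : ℂ) ^ (s - 1) * f (x * c)) (Ioi 0) := fun {c} hc => by
    have := (MellinConvergent.comp_mul_left (f := f) (s := s) hc).2 hf.1
    simpa only [MellinConvergent, smul_eq_mul, mul_comm c] using this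
  have hint : Integrable (fun p : ℝ × X => (p.1 : ℂ) ^ (s - 1) * f (p.1 * g p.2) * h p.2)
        ((volume.restrict (Ioi 0)).prod ν) := by
    rw [integrable_prod_iff' hmeas]
    constructor
    · filter_upwards [hg0] with t ht
      exact (hfc ht).mul_const _
    · refine (hi.norm.const_mul (∫ x in Ioi (0 : ℝ), ‖(x : ℂ) ^ (s - 1) * f x‖)).congr ?_
      filter_upwards [hg0] with t ht
      have hscale := integral_comp_mul_left_Ioi (fun x : ℝ => ‖(x : ℂ) ^ (s - 1) * f x‖) 0 ht
      rw [mul_zero] at hscale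
      have hcongr : ∫ x in Ioi (0 : ℝ), ‖(x : ℂ) ^ (s - 1) * f (x * g t) * h t‖
          = ∫ x in Ioi (0 : ℝ), (‖(g t : ℂ) ^ (1 - s)‖ * ‖h t‖) *
            ‖((g t * x : ℝ) : ℂ) ^ (s - 1) * f (g t * x)‖ := by
        refine setIntegral_congr_fun measurableSet_Ioi fun x hx => ?_
        have hgc : (g t : ℂ) ^ (1 - s) * (g t : ℂ) ^ (s - 1) = 1 := by
          rw [← Complex.cpow_add _ _ (by exact_mod_cast ht.ne')]
          simp
        have hgn := congrArg norm hgc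
        rw [norm_mul, norm_one] at hgn
        simp only [Complex.ofReal_mul,
          Complex.mul_cpow_ofReal_nonneg ht.le (le_of_lt (mem_Ioi.1 hx)), norm_mul]
        rw [mul_comm (g t) x]
        linear_combination (-‖(x : ℂ) ^ (s - 1)‖ * ‖f (x * g t)‖ * ‖h t‖) * hgn
      rw [hcongr, integral_const_mul, hscale, smul_eq_mul]
      have hgs : (g t : ℂ) ^ (1 - s) = g t * (g t : ℂ) ^ (-s) := by
        rw [sub_eq_add_neg, Complex.cpow_add _ _ (by exact_mod_cast ht.ne'), Complex.cpow_one]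
      rw [hgs, norm_mul, norm_mul, Complex.norm_real, Real.norm_of_nonneg ht.le]
      field_simp
  refine ⟨hint, ?_⟩
  rw [integral_prod_symm _ hint, ← integral_const_mul]
  refine integral_congr_ae ?_
  filter_upwards [hg0] with t ht
  have hm := mellin_comp_mul_right f s ht
  rw [hf.2, mellin] at hm
  simp only [smul_eq_mul] at hm
  simp only [integral_mul_const, hm]
  ring

theorem hasMellin_exp_neg {s : ℂ} (hs : 0 < s.re) :
    HasMellin (fun x : ℝ => ((Real.exp (-x) : ℝ) : ℂ)) s (Complex.Gamma s) := by
  refine ⟨?_, ?_⟩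
  · simpa only [MellinConvergent, smul_eq_mul, mul_comm] using Complex.GammaIntegral_convergent hs
  · rw [← Complex.GammaIntegral_eq_mellin, Complex.Gamma_eq_integral hs]

/-- Euler's beta integral in the form `∫₀^∞ v ^ (a - 1) * (1 + v) ^ (-(a + b)) dv`. -/
theorem integral_cpow_mul_one_add_cpow {a b : ℂ} (ha : 0 < a.re) (hb : 0 < b.re) :
    IntegrableOn (fun v : ℝ => (v : ℂ) ^ (a - 1) * ((1 + v : ℝ) : ℂ) ^ (-(a + b))) (Ioi 0) ∧
      ∫ v in Ioi (0 : ℝ), (v : ℂ) ^ (a - 1) * ((1 + v : ℝ) : ℂ) ^ (-(a + b))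
        = Complex.Gamma a * Complex.Gamma b / Complex.Gamma (a + b) := by
  have hab : 0 < (a + b).re := by simpa using add_pos ha hb
  have hΓ : Complex.Gamma (a + b) ≠ 0 := Complex.Gamma_ne_zero_of_re_pos hab
  have hcongr : EqOn (fun x : ℝ => (x : ℂ) ^ (b - 1) * ((Real.exp (-x) : ℝ) : ℂ))
      (fun x : ℝ => ((x : ℂ) ^ (a + b - 1) * ((Real.exp (-x) : ℝ) : ℂ)) * (x : ℂ) ^ (-a))
      (Ioi 0) := fun x hx => by
    have hx0 : (x : ℂ) ≠ 0 := by exact_mod_cast (mem_Ioi.1 hx).ne'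
    simp only
    rw [show b - 1 = (a + b - 1) + -a by ring, Complex.cpow_add _ _ hx0]
    ring
  have hb' := hasMellin_exp_neg hb
  obtain ⟨hint, hval⟩ := (hasMellin_exp_neg ha).integrable_prod_comp_mul
    (ν := volume.restrict (Ioi (0 : ℝ))) (by fun_prop) measurable_id
    (ae_restrict_mem measurableSet_Ioi)
    (h := fun x : ℝ => (x : ℂ) ^ (a + b - 1) * ((Real.exp (-x) : ℝ) : ℂ))
    (Measurable.aestronglyMeasurable (by fun_prop))
    (IntegrableOn.congr_fun hb'.1 hcongr measurableSet_Ioi)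
  simp only [id_eq] at hint hval
  have hinner : EqOn (fun v : ℝ => ∫ x in Ioi (0 : ℝ),
      (v : ℂ) ^ (a - 1) * ((Real.exp (-(v * x)) : ℝ) : ℂ) *
        ((x : ℂ) ^ (a + b - 1) * ((Real.exp (-x) : ℝ) : ℂ)))
      (fun v : ℝ => Complex.Gamma (a + b) *
        ((v : ℂ) ^ (a - 1) * ((1 + v : ℝ) : ℂ) ^ (-(a + b)))) (Ioi 0) := fun v hv => by
    have hm := mellin_comp_mul_left (fun x : ℝ => ((Real.exp (-x) : ℝ) : ℂ)) (a + b)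
      (a := 1 + v) (by linarith [mem_Ioi.1 hv])
    rw [(hasMellin_exp_neg hab).2, mellin, smul_eq_mul] at hm
    simp only
    rw [show Complex.Gamma (a + b) * ((v : ℂ) ^ (a - 1) * ((1 + v : ℝ) : ℂ) ^ (-(a + b)))
      = (v : ℂ) ^ (a - 1) * (((1 + v : ℝ) : ℂ) ^ (-(a + b)) * Complex.Gamma (a + b)) by ring,
      ← hm, ← integral_const_mul]
    refine integral_congr_ae (.of_forall fun x => ?_)
    simp only [smul_eq_mul]
    rw [show -((1 + v) * x) = -(v * x) + -x by ring, Real.exp_add]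
    push_cast
    ring
  constructor
  · have h1 := IntegrableOn.congr_fun hint.integral_prod_left hinner measurableSet_Ioi
    simpa only [inv_mul_cancel_left₀ hΓ] using! h1.const_mul (Complex.Gamma (a + b))⁻¹
  · rw [integral_prod _ hint, setIntegral_congr_fun measurableSet_Ioi hinner, integral_const_mul,
      ← setIntegral_congr_fun measurableSet_Ioi hcongr] at hval
    have hb2 := hb'.2
    rw [mellin] at hb2
    simp only [smul_eq_mul] at hb2
    rw [eq_div_iff hΓ, ← hb2, mul_comm, hval]

/-- The Fourier-Laplace transform of a power of the hyperbolic cosine. -/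
theorem integral_exp_mul_cosh_cpow {μ s : ℂ} (h₁ : 0 < (s + μ).re) (h₂ : 0 < (s - μ).re) :
    Integrable (fun t : ℝ => Complex.exp (μ * t) * (Real.cosh t : ℂ) ^ (-s)) ∧
      ∫ t : ℝ, Complex.exp (μ * t) * (Real.cosh t : ℂ) ^ (-s)
        = 2 ^ (s - 1) * Complex.Gamma ((s + μ) / 2) * Complex.Gamma ((s - μ) / 2)
          / Complex.Gamma s := by
  have ha : 0 < ((s + μ) / 2).re := by
    rw [show (s + μ) / 2 = (s + μ) / (2 : ℝ) by simp, Complex.div_ofReal_re]; positivity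
  have hb : 0 < ((s - μ) / 2).re := by
    rw [show (s - μ) / 2 = (s - μ) / (2 : ℝ) by simp, Complex.div_ofReal_re]; positivity
  obtain ⟨hi, hv⟩ := integral_cpow_mul_one_add_cpow ha hb
  have himage : (fun t : ℝ => Real.exp (2 * t)) '' univ = Ioi 0 := by
    rw [image_univ]
    ext x
    refine ⟨?_, fun hx => ⟨Real.log x / 2, ?_⟩⟩
    · rintro ⟨t, rfl⟩
      exact Real.exp_pos _
    · simp only
      rw [mul_div_cancel₀ _ two_ne_zero, Real.exp_log hx]
  have hinj : InjOn (fun t : ℝ => Real.exp (2 * t)) univ := fun x _ y _ hxy => by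
    have := Real.exp_injective hxy
    linarith
  have hderiv : ∀ t ∈ (univ : Set ℝ), HasDerivWithinAt (fun t : ℝ => Real.exp (2 * t))
      (Real.exp (2 * t) * 2) univ t := fun t _ => by
    simpa only [mul_one] using! (((hasDerivAt_id t).const_mul 2).exp).hasDerivWithinAt
  have hpt : ∀ t : ℝ, |Real.exp (2 * t) * 2| • (((Real.exp (2 * t) : ℝ) : ℂ) ^ ((s + μ) / 2 - 1) *
      ((1 + Real.exp (2 * t) : ℝ) : ℂ) ^ (-((s + μ) / 2 + (s - μ) / 2)))
      = 2 ^ (1 - s) * (Complex.exp (μ * t) * (Real.cosh t : ℂ) ^ (-s)) := fun t => by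
    have hcosh : 1 + Real.exp (2 * t) = 2 * (Real.exp t * Real.cosh t) := by
      rw [Real.cosh_eq, two_mul t, Real.exp_add, Real.exp_neg]
      field_simp
      ring
    have hexp : ∀ (x : ℝ) (z : ℂ), ((Real.exp x : ℝ) : ℂ) ^ z = Complex.exp (x * z) :=
      fun x z => by
        rw [Complex.cpow_def_of_ne_zero (by exact_mod_cast (Real.exp_pos x).ne'),
          ← Complex.ofReal_log (Real.exp_pos x).le, Real.log_exp]
    rw [abs_of_pos (by positivity), hcosh, Complex.real_smul, Complex.ofReal_mul 2,
      Complex.mul_cpow_ofReal_nonneg zero_le_two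
        (mul_pos (Real.exp_pos t) (Real.cosh_pos t)).le, Complex.ofReal_mul (Real.exp t),
      Complex.mul_cpow_ofReal_nonneg (Real.exp_pos t).le (Real.cosh_pos t).le, hexp, hexp,
      show (s + μ) / 2 + (s - μ) / 2 = s by ring, sub_eq_add_neg 1 s,
      Complex.cpow_add _ _ two_ne_zero, Complex.cpow_one]
    have he : Complex.exp (μ * t) = Complex.exp ((2 * t : ℝ) : ℂ) *
        Complex.exp ((2 * t : ℝ) * ((s + μ) / 2 - 1)) * Complex.exp (t * -s) := by
      rw [← Complex.exp_add, ← Complex.exp_add]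
      congr 1
      push_cast
      ring
    rw [he]
    push_cast
    ring
  have h2 : (2 : ℂ) ^ (s - 1) * 2 ^ (1 - s) = 1 := by
    rw [← Complex.cpow_add _ _ two_ne_zero]
    simp
  rw [← himage] at hi hv
  rw [integrableOn_image_iff_integrableOn_abs_deriv_smul MeasurableSet.univ hderiv hinj,
    integrableOn_univ] at hi
  rw [integral_image_eq_integral_abs_deriv_smul MeasurableSet.univ hderiv hinj,
    Measure.restrict_univ] at hv
  simp only [hpt] at hi hv
  constructor
  · refine (hi.const_mul (2 ^ (s - 1))).congr (.of_forall fun t => ?_)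
    simp only [← mul_assoc, h2, one_mul]
  · rw [integral_const_mul, show (s + μ) / 2 + (s - μ) / 2 = s by ring] at hv
    rw [mul_assoc, mul_div_assoc, ← hv, ← mul_assoc, h2, one_mul]

theorem integral_cosh_mul_cosh_cpow {μ s : ℂ} (h₁ : 0 < (s + μ).re) (h₂ : 0 < (s - μ).re) :
    IntegrableOn (fun t : ℝ => Complex.cosh (μ * t) * (Real.cosh t : ℂ) ^ (-s)) (Ioi 0) ∧
      ∫ t in Ioi (0 : ℝ), Complex.cosh (μ * t) * (Real.cosh t : ℂ) ^ (-s)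
        = 2 ^ (s - 2) * Complex.Gamma ((s + μ) / 2) * Complex.Gamma ((s - μ) / 2)
          / Complex.Gamma s := by
  obtain ⟨hi, hv⟩ := integral_exp_mul_cosh_cpow h₁ h₂
  have hpt : (fun t : ℝ => Complex.cosh (μ * t) * (Real.cosh t : ℂ) ^ (-s))
      = fun t : ℝ => (1 / 2 : ℂ) * (Complex.exp (μ * t) * (Real.cosh t : ℂ) ^ (-s)
        + Complex.exp (μ * (-t : ℝ)) * (Real.cosh (-t) : ℂ) ^ (-s)) := by
    funext t
    rw [Complex.cosh, Real.cosh_neg, Complex.ofReal_neg, mul_neg]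
    ring
  rw [hpt]
  refine ⟨((hi.add hi.comp_neg).const_mul _).integrableOn, ?_⟩
  rw [integral_const_mul, integral_add hi.integrableOn hi.comp_neg.integrableOn,
    integral_comp_neg_Ioi 0 (fun t : ℝ => Complex.exp (μ * t) * (Real.cosh t : ℂ) ^ (-s)),
    neg_zero, add_comm, intervalIntegral.integral_Iic_add_Ioi hi.integrableOn hi.integrableOn, hv,
    show s - 2 = s - 1 + -1 by ring, Complex.cpow_add _ (-1) two_ne_zero, Complex.cpow_neg_one]
  ring

theorem measurable_besselK (μ : ℂ) : Measurable (besselK μ) := by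
  refine (StronglyMeasurable.integral_prod_right' (ν := volume.restrict (Ioi (0 : ℝ)))
    (f := fun p : ℝ × ℝ => Complex.exp (-(p.1 : ℂ) * Real.cosh p.2) * Complex.cosh (μ * p.2))
    (Continuous.stronglyMeasurable ?_)).measurable
  have : Continuous fun p : ℝ × ℝ => Real.cosh p.2 := Real.continuous_cosh.comp continuous_snd
  fun_prop

/-- The Mellin transform of the modified Bessel function of the second kind. -/
theorem hasMellin_besselK {μ s : ℂ} (h₁ : 0 < (s + μ).re) (h₂ : 0 < (s - μ).re) :
    HasMellin (besselK μ) s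
      (2 ^ (s - 2) * Complex.Gamma ((s + μ) / 2) * Complex.Gamma ((s - μ) / 2)) := by
  have hs : 0 < s.re := by
    simp only [Complex.add_re, Complex.sub_re] at h₁ h₂
    linarith
  obtain ⟨hi, hv⟩ := integral_cosh_mul_cosh_cpow h₁ h₂
  obtain ⟨hint, hval⟩ := (hasMellin_exp_neg hs).integrable_prod_comp_mul
    (ν := volume.restrict (Ioi (0 : ℝ))) (by fun_prop) Real.measurable_cosh
    (.of_forall Real.cosh_pos) (h := fun t : ℝ => Complex.cosh (μ * t))
    (Continuous.aestronglyMeasurable (by fun_prop)) hi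
  have hinner : (fun x : ℝ => ∫ t in Ioi (0 : ℝ), (x : ℂ) ^ (s - 1) *
      ((Real.exp (-(x * Real.cosh t)) : ℝ) : ℂ) * Complex.cosh (μ * t))
      = fun x : ℝ => (x : ℂ) ^ (s - 1) * besselK μ x := by
    funext x
    simp only [besselK, mul_assoc, integral_const_mul]
    push_cast
    simp only [neg_mul]
  have hint' := hint.integral_prod_left
  rw [integral_prod _ hint, hv] at hval
  simp only [hinner] at hint' hval
  refine ⟨hint', ?_⟩
  rw [mellin]
  simp only [smul_eq_mul]
  rw [hval, mul_div_cancel₀ _ (Complex.Gamma_ne_zero_of_re_pos hs)]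

/-- The double Mellin transform of the integral in Stade's formula, as a triple integral. -/
theorem integrable_besselK_mul_besselK {μ s₁ s₂ ν : ℂ} (h₁ : 0 < (s₁ + μ).re)
    (h₂ : 0 < (s₁ - μ).re) (h₃ : 0 < (s₂ + μ).re) (h₄ : 0 < (s₂ - μ).re)
    (h₅ : 0 < (s₂ / 2 + ν).re) (h₆ : 0 < (s₁ / 2 - ν).re) :
    Integrable (fun p : (ℝ × ℝ) × ℝ => (p.1.1 : ℂ) ^ (s₁ - 1) * (p.1.2 : ℂ) ^ (s₂ - 1) *
        (besselK μ (2 * π * p.1.1 * √(1 + p.2)) * besselK μ (2 * π * p.1.2 * √(1 + p.2⁻¹)) *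
          (p.2 : ℂ) ^ (ν - 1)))
      (((volume.restrict (Ioi 0)).prod (volume.restrict (Ioi 0))).prod
        (volume.restrict (Ioi 0))) ∧
    ∫ p : (ℝ × ℝ) × ℝ, (p.1.1 : ℂ) ^ (s₁ - 1) * (p.1.2 : ℂ) ^ (s₂ - 1) *
        (besselK μ (2 * π * p.1.1 * √(1 + p.2)) * besselK μ (2 * π * p.1.2 * √(1 + p.2⁻¹)) *
          (p.2 : ℂ) ^ (ν - 1))
      ∂(((volume.restrict (Ioi 0)).prod (volume.restrict (Ioi 0))).prod
        (volume.restrict (Ioi 0)))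
    = 16⁻¹ * (π : ℂ) ^ (-s₁ - s₂)
      * Complex.Gamma ((s₁ + μ) / 2) * Complex.Gamma ((s₁ - μ) / 2)
      * Complex.Gamma ((s₂ + μ) / 2) * Complex.Gamma ((s₂ - μ) / 2)
      * Complex.Gamma (s₂ / 2 + ν) * Complex.Gamma (s₁ / 2 - ν)
      / Complex.Gamma ((s₁ + s₂) / 2) := by
  have hK := measurable_besselK μ
  have h2π : (0 : ℝ) < 2 * π := by positivity
  have hg : ∀ {x : ℝ}, 0 < x → 0 < 2 * π * √(1 + x) := fun {x} hx =>
    mul_pos h2π (Real.sqrt_pos.2 (by linarith))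
  obtain ⟨hi, hv⟩ := integral_cpow_mul_one_add_cpow h₅ h₆
  rw [show s₂ / 2 + ν + (s₁ / 2 - ν) = (s₁ + s₂) / 2 by ring] at hi hv
  have hsqrt : ∀ {x : ℝ} (z : ℂ), 0 < x → (√x : ℂ) ^ z = (x : ℂ) ^ (z / 2) := fun {x} z hx => by
    rw [Real.sqrt_eq_rpow, ← Complex.cpow_mul_ofReal_nonneg hx.le]
    congr 1
    push_cast
    ring
  have hpt : EqOn (fun u : ℝ => ((2 * π : ℝ) : ℂ) ^ (-s₁ - s₂) *
        ((u : ℂ) ^ (s₂ / 2 + ν - 1) * ((1 + u : ℝ) : ℂ) ^ (-((s₁ + s₂) / 2))))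
      (fun u : ℝ => (u : ℂ) ^ (ν - 1) * ((2 * π * √(1 + u) : ℝ) : ℂ) ^ (-s₁) *
        ((2 * π * √(1 + u⁻¹) : ℝ) : ℂ) ^ (-s₂)) (Ioi 0) := fun u hu => by
    have hu : 0 < u := hu
    have hu0 : (u : ℂ) ≠ 0 := by exact_mod_cast hu.ne'
    have hu1 : ((1 + u : ℝ) : ℂ) ≠ 0 := by exact_mod_cast (by positivity : 1 + u ≠ 0)
    have hinv : 1 + u⁻¹ = (1 + u) * u⁻¹ := by rw [add_mul, mul_inv_cancel₀ hu.ne']; ring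
    have hπ0 : ((2 * π : ℝ) : ℂ) ≠ 0 := by exact_mod_cast h2π.ne'
    simp only
    rw [Complex.ofReal_mul (2 * π), Complex.ofReal_mul (2 * π),
      Complex.mul_cpow_ofReal_nonneg h2π.le (Real.sqrt_nonneg _),
      Complex.mul_cpow_ofReal_nonneg h2π.le (Real.sqrt_nonneg _),
      hsqrt _ (by positivity), hsqrt _ (by positivity), hinv, Complex.ofReal_mul (1 + u),
      Complex.mul_cpow_ofReal_nonneg (by positivity) (by positivity), Complex.ofReal_inv,
      Complex.inv_cpow _ _ (by
        rw [Complex.arg_ofReal_of_nonneg hu.le]; exact Real.pi_pos.ne),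
      ← Complex.cpow_neg,
      show -s₁ - s₂ = -s₁ + -s₂ by ring, Complex.cpow_add _ _ hπ0,
      show s₂ / 2 + ν - 1 = (ν - 1) + -(-s₂ / 2) by ring, Complex.cpow_add _ _ hu0,
      show -((s₁ + s₂) / 2) = -s₁ / 2 + -s₂ / 2 by ring, Complex.cpow_add _ _ hu1]
    ring
  have hi' := IntegrableOn.congr_fun (hi.const_mul (((2 * π : ℝ) : ℂ) ^ (-s₁ - s₂))) hpt
    measurableSet_Ioi
  obtain ⟨hint₂, hval₂⟩ := (hasMellin_besselK h₃ h₄).integrable_prod_comp_mul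
    (ν := volume.restrict (Ioi (0 : ℝ))) hK
    (g := fun u : ℝ => 2 * π * √(1 + u⁻¹)) (by fun_prop)
    ((ae_restrict_mem measurableSet_Ioi).mono fun u hu => hg (inv_pos.2 hu))
    (h := fun u : ℝ => (u : ℂ) ^ (ν - 1) * ((2 * π * √(1 + u) : ℝ) : ℂ) ^ (-s₁))
    (Measurable.aestronglyMeasurable (by fun_prop)) hi'
  have hg' : ∀ᵐ q : ℝ × ℝ ∂(volume.restrict (Ioi (0 : ℝ))).prod (volume.restrict (Ioi (0 : ℝ))),
      0 < 2 * π * √(1 + q.2) := by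
    have hpos : ∀ᵐ u ∂volume.restrict (Ioi (0 : ℝ)), 0 < 2 * π * √(1 + u) :=
      (ae_restrict_mem measurableSet_Ioi).mono fun u hu => hg hu
    exact Measure.quasiMeasurePreserving_snd.ae hpos
  obtain ⟨hint₁, hval₁⟩ := (hasMellin_besselK h₁ h₂).integrable_prod_comp_mul
    (ν := (volume.restrict (Ioi (0 : ℝ))).prod (volume.restrict (Ioi (0 : ℝ)))) hK
    (g := fun q : ℝ × ℝ => 2 * π * √(1 + q.2)) (by fun_prop)
    hg'
    (h := fun q : ℝ × ℝ => (q.1 : ℂ) ^ (s₂ - 1) * besselK μ (q.1 * (2 * π * √(1 + q.2⁻¹))) *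
      (q.2 : ℂ) ^ (ν - 1))
    (Measurable.aestronglyMeasurable (by fun_prop))
    (hint₂.congr (.of_forall fun q => by ring))
  have hassoc := measurePreserving_prodAssoc (volume.restrict (Ioi (0 : ℝ)))
    (volume.restrict (Ioi (0 : ℝ))) (volume.restrict (Ioi (0 : ℝ)))
  have hcomp : (fun p : (ℝ × ℝ) × ℝ => (p.1.1 : ℂ) ^ (s₁ - 1) * (p.1.2 : ℂ) ^ (s₂ - 1) *
        (besselK μ (2 * π * p.1.1 * √(1 + p.2)) * besselK μ (2 * π * p.1.2 * √(1 + p.2⁻¹)) *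
          (p.2 : ℂ) ^ (ν - 1)))
      = (fun p : ℝ × ℝ × ℝ => (p.1 : ℂ) ^ (s₁ - 1) * besselK μ (p.1 * (2 * π * √(1 + p.2.2))) *
        ((p.2.1 : ℂ) ^ (s₂ - 1) * besselK μ (p.2.1 * (2 * π * √(1 + p.2.2⁻¹))) *
          (p.2.2 : ℂ) ^ (ν - 1))) ∘ MeasurableEquiv.prodAssoc := by
    funext p
    simp only [Function.comp, MeasurableEquiv.prodAssoc, MeasurableEquiv.coe_mk,
      Equiv.prodAssoc_apply]
    rw [show 2 * π * p.1.1 * √(1 + p.2) = p.1.1 * (2 * π * √(1 + p.2)) by ring,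
      show 2 * π * p.1.2 * √(1 + p.2⁻¹) = p.1.2 * (2 * π * √(1 + p.2⁻¹)) by ring]
    ring
  rw [← hassoc.integral_comp'] at hval₁
  rw [hcomp]
  refine ⟨(hassoc.integrable_comp_emb (MeasurableEquiv.measurableEmbedding _)).2 hint₁,
    hval₁.trans ?_⟩
  rw [integral_congr_ae (g := fun q : ℝ × ℝ => (q.1 : ℂ) ^ (s₂ - 1) *
      besselK μ (q.1 * (2 * π * √(1 + q.2⁻¹))) *
        ((q.2 : ℂ) ^ (ν - 1) * ((2 * π * √(1 + q.2) : ℝ) : ℂ) ^ (-s₁)))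
      (.of_forall fun q => by ring), hval₂,
    ← setIntegral_congr_fun measurableSet_Ioi hpt, integral_const_mul, hv,
    Complex.ofReal_mul, Complex.mul_cpow_ofReal_nonneg zero_le_two Real.pi_pos.le,
    Complex.ofReal_ofNat]
  have h2 : (2 : ℂ) ^ (-s₁ - s₂) * 2 ^ (s₁ - 2) * 2 ^ (s₂ - 2) = 16⁻¹ := by
    rw [← Complex.cpow_add _ _ two_ne_zero, ← Complex.cpow_add _ _ two_ne_zero,
      show -s₁ - s₂ + (s₁ - 2) + (s₂ - 2) = -(4 : ℕ) by push_cast; ring, Complex.cpow_neg,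
      Complex.cpow_natCast]
    norm_num
  rw [← h2]
  ring

/-- The double Mellin transform of Jacquet's Whittaker function converges absolutely and
equals the ratio of Gamma factors from Stade's formula. -/
theorem jacquetW_double_mellin (α β γ : ℂ) (hsum : α + β + γ = 0)
    (hα : α.re = 0) (hβ : β.re = 0) (hγ : γ.re = 0)
    (w₁ w₂ : ℝ) (hw₁ : 0 < w₁) (hw₂ : 0 < w₂) :
    IntegrableOn (fun p : ℝ × ℝ =>
      jacquetW α β γ p.1 p.2 * ((p.1 ^ (w₁ - 1) : ℝ) : ℂ) * ((p.2 ^ (w₂ - 1) : ℝ) : ℂ))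
      (Ioi 0 ×ˢ Ioi 0) ∧
    ∫ p in (Ioi (0:ℝ) ×ˢ Ioi (0:ℝ)),
        jacquetW α β γ p.1 p.2 * ((p.1 ^ (w₁ - 1) : ℝ) : ℂ) * ((p.2 ^ (w₂ - 1) : ℝ) : ℂ)
      = (π : ℂ) ^ (-(w₁ : ℂ) - w₂)
        * Complex.Gamma ((1 + w₂ - α) / 2) * Complex.Gamma ((1 + w₂ - β) / 2)
        * Complex.Gamma ((1 + w₂ - γ) / 2) * Complex.Gamma ((1 + w₁ + α) / 2)
        * Complex.Gamma ((1 + w₁ + β) / 2) * Complex.Gamma ((1 + w₁ + γ) / 2)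
        / Complex.Gamma ((2 + w₁ + w₂) / 2) := by
  have hre : ∀ z : ℂ, (z / 2).re = z.re / 2 := fun z => by
    rw [show z / 2 = z / (2 : ℝ) by simp, Complex.div_ofReal_re]
  have hγ' : γ = -α - β := by linear_combination hsum
  obtain ⟨hint, hval⟩ := integrable_besselK_mul_besselK (μ := (α - β) / 2)
    (s₁ := 1 + w₁ - γ / 2) (s₂ := 1 + w₂ + γ / 2) (ν := -(3 * γ) / 4)
    (by simp [hre, hα, hβ, hγ]; linarith) (by simp [hre, hα, hβ, hγ]; linarith)
    (by simp [hre, hα, hβ, hγ]; linarith) (by simp [hre, hα, hβ, hγ]; linarith)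
    (by
      rw [show (1 + w₂ + γ / 2) / 2 + -(3 * γ) / 4 = (1 + w₂ - γ) / 2 by ring]
      simp [hre, hγ]; linarith)
    (by
      rw [show (1 + w₁ - γ / 2) / 2 - -(3 * γ) / 4 = (1 + w₁ + γ) / 2 by ring]
      simp [hre, hγ]; linarith)
  have hpt : EqOn (fun p : ℝ × ℝ => 16 * (π : ℂ) ^ (2 : ℂ) * ∫ u in Ioi (0 : ℝ),
        (p.1 : ℂ) ^ (1 + w₁ - γ / 2 - 1) * (p.2 : ℂ) ^ (1 + w₂ + γ / 2 - 1) *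
        (besselK ((α - β) / 2) (2 * π * p.1 * √(1 + u)) *
          besselK ((α - β) / 2) (2 * π * p.2 * √(1 + u⁻¹)) * (u : ℂ) ^ (-(3 * γ) / 4 - 1)))
      (fun p : ℝ × ℝ =>
        jacquetW α β γ p.1 p.2 * ((p.1 ^ (w₁ - 1) : ℝ) : ℂ) * ((p.2 ^ (w₂ - 1) : ℝ) : ℂ))
      (Ioi 0 ×ˢ Ioi 0) := fun p hp => by
    have h₁ : 0 < p.1 := hp.1
    have h₂ : 0 < p.2 := hp.2
    have h₁' : (p.1 : ℂ) ≠ 0 := by exact_mod_cast h₁.ne'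
    have h₂' : (p.2 : ℂ) ≠ 0 := by exact_mod_cast h₂.ne'
    have hπ : (π : ℂ) ≠ 0 := by exact_mod_cast Real.pi_ne_zero
    have hπ2 : (π : ℂ) ^ (2 : ℂ) = (π : ℂ) ^ (1 - γ / 2) * (π : ℂ) ^ (1 + γ / 2) := by
      rw [← Complex.cpow_add _ _ hπ]
      congr 1
      ring
    simp only [jacquetW]
    rw [integral_const_mul, Complex.ofReal_cpow h₁.le, Complex.ofReal_cpow h₂.le,
      Complex.ofReal_mul, Complex.ofReal_mul,
      Complex.mul_cpow_ofReal_nonneg Real.pi_pos.le h₁.le,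
      Complex.mul_cpow_ofReal_nonneg Real.pi_pos.le h₂.le,
      show (1 + w₁ - γ / 2 - 1 : ℂ) = (1 - γ / 2) + (w₁ - 1 : ℝ) by push_cast; ring,
      show (1 + w₂ + γ / 2 - 1 : ℂ) = (1 + γ / 2) + (w₂ - 1 : ℝ) by push_cast; ring,
      Complex.cpow_add _ _ h₁', Complex.cpow_add _ _ h₂', hπ2]
    ring
  have hmeas : MeasurableSet (Ioi (0 : ℝ) ×ˢ Ioi (0 : ℝ)) :=
    measurableSet_Ioi.prod measurableSet_Ioi
  rw [Measure.prod_restrict, ← Measure.volume_eq_prod] at hint hval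
  refine ⟨IntegrableOn.congr_fun (hint.integral_prod_left.const_mul _) hpt hmeas, ?_⟩
  rw [integral_prod _ hint] at hval
  rw [← setIntegral_congr_fun hmeas hpt, integral_const_mul, hval,
    show -(1 + w₁ - γ / 2) - (1 + w₂ + γ / 2) = (-w₁ - w₂ : ℂ) + -2 by ring,
    Complex.cpow_add _ (-2) (by exact_mod_cast Real.pi_ne_zero), Complex.cpow_neg _ 2,
    show ((1 + w₁ - γ / 2 + (α - β) / 2) / 2 : ℂ) = (1 + w₁ + α) / 2 by rw [hγ']; ring,
    show ((1 + w₁ - γ / 2 - (α - β) / 2) / 2 : ℂ) = (1 + w₁ + β) / 2 by rw [hγ']; ring,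
    show ((1 + w₂ + γ / 2 + (α - β) / 2) / 2 : ℂ) = (1 + w₂ - β) / 2 by rw [hγ']; ring,
    show ((1 + w₂ + γ / 2 - (α - β) / 2) / 2 : ℂ) = (1 + w₂ - α) / 2 by rw [hγ']; ring,
    show (1 + w₂ + γ / 2) / 2 + -(3 * γ) / 4 = (1 + w₂ - γ) / 2 by ring,
    show (1 + w₁ - γ / 2) / 2 - -(3 * γ) / 4 = (1 + w₁ + γ) / 2 by ring,
    show (1 + w₁ - γ / 2 + (1 + w₂ + γ / 2)) / 2 = ((2 + w₁ + w₂) / 2 : ℂ) by ring]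
  have hπ2 : (π : ℂ) ^ (2 : ℂ) * ((π : ℂ) ^ (2 : ℂ))⁻¹ = 1 :=
    mul_inv_cancel₀ (by simp [Real.pi_ne_zero])
  generalize (π : ℂ) ^ (2 : ℂ) = c at hπ2 ⊢
  linear_combination (π : ℂ) ^ (-(w₁ : ℂ) - w₂)
        * Complex.Gamma ((1 + w₂ - α) / 2) * Complex.Gamma ((1 + w₂ - β) / 2)
        * Complex.Gamma ((1 + w₂ - γ) / 2) * Complex.Gamma ((1 + w₁ + α) / 2)
        * Complex.Gamma ((1 + w₁ + β) / 2) * Complex.Gamma ((1 + w₁ + γ) / 2)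
        / Complex.Gamma ((2 + w₁ + w₂) / 2) * hπ2
end

section
/- Let α, β, γ ∈ ℂ with α + β + γ = 0 and Re α = Re β = Re γ = 0, and let σ₁, σ₂ > 0 be real. Then for all y₁, y₂ > 0, Jacquet's Whittaker function admits the double inverse Mellin representation W(y₁,y₂) = (1/(4π²))·∫_{−∞}^{∞} ∫_{−∞}^{∞} [Γ((σ₂+it₂−α)/2)·Γ((σ₂+it₂−β)/2)·Γ((σ₂+it₂−γ)/2)·Γ((σ₁+it₁+α)/2)·Γ((σ₁+it₁+β)/2)·Γ((σ₁+it₁+γ)/2) / Γ((σ₁+it₁+σ₂+it₂)/2)] · (πy₁)^{1−σ₁−it₁}·(πy₂)^{1−σ₂−it₂} dt₁ dt₂, the double integral converging absolutely. -/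
open MeasureTheory Real Set

/-- A complex power of a positive real number, written with the real logarithm. -/
lemma ofReal_cpow_eq_exp {x : ℝ} (hx : 0 < x) (z : ℂ) :
    (x : ℂ) ^ z = Complex.exp (Real.log x * z) := by
  rw [Complex.cpow_def_of_ne_zero (by exact_mod_cast hx.ne'), Complex.ofReal_log hx.le]

lemma ofReal_eq_exp_log {x : ℝ} (hx : 0 < x) : (x : ℂ) = Complex.exp (Real.log x) := by
  rw [← Complex.ofReal_exp, Real.exp_log hx]

/-- The Gamma function is continuous along a vertical line in the right half-plane. -/
lemma continuous_Gamma_vertical {σ : ℝ} (hσ : 0 < σ) :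
    Continuous fun t : ℝ => Complex.Gamma (σ + t * Complex.I) := by
  refine continuous_iff_continuousAt.2 fun t => ?_
  refine ContinuousAt.comp (g := Complex.Gamma)
    (Complex.differentiableAt_Gamma _ fun m h => ?_).continuousAt (by fun_prop)
  have := congrArg Complex.re h
  simp at this
  have := m.cast_nonneg (α := ℝ)
  linarith

/-- The Gamma function is integrable along a vertical line in the right half-plane. -/
lemma integrable_Gamma_vertical {σ : ℝ} (hσ : 0 < σ) :
    Integrable fun t : ℝ => Complex.Gamma (σ + t * Complex.I) := by
  have hint := integrable_inv_one_add_sq.const_mul (Real.Gamma (σ + 2) * (min (σ ^ 2) 1)⁻¹)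
  refine hint.mono' (continuous_Gamma_vertical hσ).aestronglyMeasurable (.of_forall fun t => ?_)
  set s : ℂ := σ + t * Complex.I with hs
  have hre : s.re = σ := by simp [hs]
  have him : s.im = t := by simp [hs]
  have hs0 : s ≠ 0 := fun h => hσ.ne' (by rw [← hre, h, Complex.zero_re])
  have hs1 : s + 1 ≠ 0 := fun h => by
    have := congrArg Complex.re h
    simp [hre] at this
    linarith
  have hG : Complex.Gamma (s + 2) = (s + 1) * (s * Complex.Gamma s) := by
    rw [← Complex.Gamma_add_one s hs0, ← Complex.Gamma_add_one _ hs1]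
    congr 1
    ring
  have hle : ‖Complex.Gamma (s + 2)‖ ≤ Real.Gamma (σ + 2) := by
    have := norm_Gamma_le_Gamma_re (s := s + 2) (by simp [hre]; linarith)
    simpa [hre] using this
  have hsq : ‖s‖ ^ 2 = σ ^ 2 + t ^ 2 := by
    rw [Complex.sq_norm, Complex.normSq_apply, hre, him]
    ring
  have hmono : ‖s‖ ≤ ‖s + 1‖ := by
    refine le_of_sq_le_sq ?_ (norm_nonneg _)
    rw [Complex.sq_norm, Complex.sq_norm, Complex.normSq_apply, Complex.normSq_apply]
    simp only [Complex.add_re, Complex.add_im, Complex.one_re, Complex.one_im, hre, him]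
    nlinarith
  have hm : 0 < min (σ ^ 2) 1 := lt_min (by positivity) one_pos
  have hlow : min (σ ^ 2) 1 * (1 + t ^ 2) ≤ ‖s + 1‖ * ‖s‖ := by
    have h1 := min_le_left (σ ^ 2) 1
    have h2 := min_le_right (σ ^ 2) 1
    nlinarith [norm_nonneg s, sq_nonneg t]
  rw [hG, norm_mul, norm_mul] at hle
  rw [mul_assoc, ← mul_inv, ← div_eq_mul_inv, le_div_iff₀ (by positivity)]
  calc _ ≤ ‖Complex.Gamma s‖ * (‖s + 1‖ * ‖s‖) := by gcongr
    _ ≤ _ := by linarith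

/-- The product of two Gamma functions is integrable along a vertical line. -/
lemma integrable_Gamma_mul_Gamma_vertical {σ : ℝ} (hσ : 0 < σ) {a b : ℂ} (ha : a.re = 0)
    (hb : b.re = 0) :
    Integrable fun t : ℝ => Complex.Gamma ((σ + t * Complex.I + a) / 2)
      * Complex.Gamma ((σ + t * Complex.I + b) / 2) := by
  have hσ' : 0 < σ / 2 := half_pos hσ
  have key : ∀ {c : ℂ}, c.re = 0 → ∀ t : ℝ, (σ + t * Complex.I + c) / 2
      = ((σ / 2 : ℝ) : ℂ) + (((t + c.im) / 2 : ℝ) : ℂ) * Complex.I := fun hc t => by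
    apply Complex.ext <;> simp [hc]
  simp only [key ha, key hb]
  refine Integrable.mul_bdd (c := Real.Gamma (σ / 2))
    (((integrable_Gamma_vertical hσ').comp_div two_ne_zero).comp_add_right a.im)
    (((continuous_Gamma_vertical hσ').comp
      (by fun_prop : Continuous fun t : ℝ => (t + b.im) / 2)).aestronglyMeasurable)
    (.of_forall fun t => ?_)
  refine (norm_Gamma_le_Gamma_re (by simpa using hσ)).trans_eq ?_
  simp

lemma image_div_one_add_Ioi : (fun w : ℝ => w / (1 + w)) '' Ioi 0 = Ioo 0 1 := by
  ext x
  simp only [mem_image, mem_Ioi, mem_Ioo]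
  constructor
  · rintro ⟨w, hw, rfl⟩
    exact ⟨by positivity, by rw [div_lt_one (by linarith)]; linarith⟩
  · rintro ⟨h0, h1⟩
    refine ⟨x / (1 - x), div_pos h0 (by linarith), ?_⟩
    have : 1 - x ≠ 0 := by linarith
    field_simp
    ring

/-- The Beta integral over the half-line. -/
lemma hasMellin_one_add_cpow {a b : ℂ} (ha : 0 < a.re) (hb : 0 < b.re) :
    HasMellin (fun w : ℝ => ((1 + w : ℝ) : ℂ) ^ (-(a + b))) a
      (Complex.Gamma a * Complex.Gamma b / Complex.Gamma (a + b)) := by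
  have hderiv : ∀ w ∈ Ioi (0 : ℝ), HasDerivWithinAt (fun w : ℝ => w / (1 + w))
      (1 / (1 + w) ^ 2) (Ioi 0) w := fun w hw => by
    have h1 : (1 + w) ≠ 0 := by have := mem_Ioi.1 hw; linarith
    have := ((hasDerivAt_id w).div ((hasDerivAt_id w).const_add 1) h1).hasDerivWithinAt
      (s := Ioi 0)
    exact this.congr_deriv (by simp)
  have hinj : InjOn (fun w : ℝ => w / (1 + w)) (Ioi 0) := fun x hx y hy h => by
    have hx := mem_Ioi.1 hx
    have hy := mem_Ioi.1 hy
    rw [div_eq_div_iff (by linarith) (by linarith)] at h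
    linarith
  have heq : EqOn (fun w : ℝ => |1 / (1 + w) ^ 2| •
      ((((w / (1 + w) : ℝ) : ℂ)) ^ (a - 1) * (1 - ((w / (1 + w) : ℝ) : ℂ)) ^ (b - 1)))
      (fun w : ℝ => (w : ℂ) ^ (a - 1) • ((1 + w : ℝ) : ℂ) ^ (-(a + b))) (Ioi 0) := fun w hw => by
    have hw := mem_Ioi.1 hw
    have h1 : 0 < 1 + w := by linarith
    have h2 : 1 - ((w / (1 + w) : ℝ) : ℂ) = (((1 + w)⁻¹ : ℝ) : ℂ) := by
      rw [← Complex.ofReal_one, ← Complex.ofReal_sub]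
      congr 1
      field_simp
      ring
    beta_reduce
    rw [abs_of_pos (by positivity), Complex.real_smul, h2, ofReal_eq_exp_log (by positivity),
      ofReal_cpow_eq_exp (by positivity), ofReal_cpow_eq_exp (by positivity),
      ofReal_cpow_eq_exp hw, ofReal_cpow_eq_exp h1, smul_eq_mul, ← Complex.exp_add,
      ← Complex.exp_add, ← Complex.exp_add, Real.log_div hw.ne' h1.ne', Real.log_inv, one_div,
      Real.log_inv, Real.log_pow]
    congr 1
    push_cast
    ring
  have hbeta := Complex.betaIntegral_convergent ha hb
  rw [intervalIntegrable_iff_integrableOn_Ioo_of_le zero_le_one, ← image_div_one_add_Ioi,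
    integrableOn_image_iff_integrableOn_abs_deriv_smul measurableSet_Ioi hderiv hinj,
    integrableOn_congr_fun heq measurableSet_Ioi] at hbeta
  refine ⟨hbeta, ?_⟩
  rw [mellin, ← setIntegral_congr_fun measurableSet_Ioi heq,
    ← integral_image_eq_integral_abs_deriv_smul measurableSet_Ioi hderiv hinj
      (fun x : ℝ => (x : ℂ) ^ (a - 1) * (1 - (x : ℂ)) ^ (b - 1)), image_div_one_add_Ioi,
    Complex.Gamma_mul_Gamma_eq_betaIntegral ha hb, mul_div_cancel_left₀, Complex.betaIntegral,
    intervalIntegral.integral_of_le zero_le_one, integral_Ioc_eq_integral_Ioo]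
  exact Complex.Gamma_ne_zero_of_re_pos (by simpa using add_pos ha hb)

lemma image_exp_two_mul_univ : (fun t : ℝ => Real.exp (2 * t)) '' univ = Ioi 0 := by
  ext x
  simp only [mem_image, mem_univ, true_and, mem_Ioi]
  refine ⟨fun ⟨t, ht⟩ => ht ▸ Real.exp_pos _, fun hx => ⟨Real.log x / 2, ?_⟩⟩
  rw [mul_div_cancel₀ _ two_ne_zero, Real.exp_log hx]

lemma integral_exp_mul_two_cosh_cpow {s μ : ℂ} (hp : 0 < (s + μ).re) (hm : 0 < (s - μ).re) :
    Integrable (fun t : ℝ => Complex.exp (μ * t) * ((2 * Real.cosh t : ℝ) : ℂ) ^ (-s)) ∧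
    ∫ t : ℝ, Complex.exp (μ * t) * ((2 * Real.cosh t : ℝ) : ℂ) ^ (-s)
      = 2⁻¹ * (Complex.Gamma ((s + μ) / 2) * Complex.Gamma ((s - μ) / 2) / Complex.Gamma s) := by
  have hderiv : ∀ t ∈ (univ : Set ℝ), HasDerivWithinAt (fun t : ℝ => Real.exp (2 * t))
      (2 * Real.exp (2 * t)) univ t := fun t _ => by
    have := (((hasDerivAt_id t).const_mul 2).exp).hasDerivWithinAt (s := univ)
    exact this.congr_deriv (by simp [mul_comm])
  have hinj : InjOn (fun t : ℝ => Real.exp (2 * t)) univ := fun x _ y _ h => by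
    have := Real.exp_injective h
    linarith
  have heq : EqOn (fun t : ℝ => |2 * Real.exp (2 * t)| •
      ((Real.exp (2 * t) : ℂ) ^ ((s + μ) / 2 - 1)
        • ((1 + Real.exp (2 * t) : ℝ) : ℂ) ^ (-((s + μ) / 2 + (s - μ) / 2))))
      (fun t : ℝ => 2 * (Complex.exp (μ * t) * ((2 * Real.cosh t : ℝ) : ℂ) ^ (-s))) univ := by
    intro t _
    have h1 : 1 + Real.exp (2 * t) = Real.exp t * (2 * Real.cosh t) := by
      rw [Real.cosh_eq, Real.exp_neg, two_mul, Real.exp_add]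
      have := (Real.exp_pos t).ne'
      field_simp
      ring
    have hc := Real.cosh_pos t
    beta_reduce
    rw [h1, abs_of_pos (by positivity), Complex.real_smul, ofReal_cpow_eq_exp (by positivity),
      ofReal_cpow_eq_exp (by positivity), ofReal_cpow_eq_exp (by positivity),
      Real.log_mul (by positivity) (by positivity), Real.log_exp, Real.log_exp, smul_eq_mul,
      Complex.ofReal_mul, Complex.ofReal_exp, Complex.ofReal_ofNat, mul_assoc, ← Complex.exp_add,
      ← Complex.exp_add, ← Complex.exp_add]
    congr 2
    push_cast
    ring
  have hp' : 0 < ((s + μ) / 2).re := by simpa using hp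
  have hm' : 0 < ((s - μ) / 2).re := by simpa using hm
  obtain ⟨hi, hv⟩ := hasMellin_one_add_cpow hp' hm'
  have hsum : (s + μ) / 2 + (s - μ) / 2 = s := by ring
  constructor
  · rw [MellinConvergent, ← image_exp_two_mul_univ,
      integrableOn_image_iff_integrableOn_abs_deriv_smul MeasurableSet.univ hderiv hinj,
      integrableOn_congr_fun heq MeasurableSet.univ, integrableOn_univ] at hi
    simpa [← mul_assoc] using hi.const_mul 2⁻¹
  · rw [mellin, ← image_exp_two_mul_univ,
      integral_image_eq_integral_abs_deriv_smul MeasurableSet.univ hderiv hinj,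
      setIntegral_congr_fun MeasurableSet.univ heq, setIntegral_univ, integral_const_mul,
      hsum] at hv
    rw [← hv, ← mul_assoc, inv_mul_cancel₀ two_ne_zero, one_mul]

lemma integral_cosh_mul_two_cosh_cpow {s μ : ℂ} (hp : 0 < (s + μ).re) (hm : 0 < (s - μ).re) :
    ∫ t in Ioi (0 : ℝ), Complex.cosh (μ * t) * ((2 * Real.cosh t : ℝ) : ℂ) ^ (-s)
      = 4⁻¹ * (Complex.Gamma ((s + μ) / 2) * Complex.Gamma ((s - μ) / 2) / Complex.Gamma s) := by
  obtain ⟨hi, hv⟩ := integral_exp_mul_two_cosh_cpow hp hm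
  obtain ⟨hi', -⟩ := integral_exp_mul_two_cosh_cpow (s := s) (μ := -μ) (by simpa using hm)
    (by simpa using hp)
  have hneg := integral_comp_neg_Iic 0
    fun t : ℝ => Complex.exp (-μ * t) * ((2 * Real.cosh t : ℝ) : ℂ) ^ (-s)
  simp only [Real.cosh_neg, Complex.ofReal_neg, neg_mul_neg, neg_zero] at hneg
  rw [← intervalIntegral.integral_Iic_add_Ioi (b := 0) hi.integrableOn hi.integrableOn, hneg,
    ← integral_add hi'.integrableOn hi.integrableOn] at hv
  have : ∀ t : ℝ, Complex.cosh (μ * t) * ((2 * Real.cosh t : ℝ) : ℂ) ^ (-s)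
      = 2⁻¹ * (Complex.exp (-μ * t) * ((2 * Real.cosh t : ℝ) : ℂ) ^ (-s)
        + Complex.exp (μ * t) * ((2 * Real.cosh t : ℝ) : ℂ) ^ (-s)) := fun t => by
    rw [Complex.cosh, neg_mul]
    ring
  simp only [this]
  rw [integral_const_mul, hv]
  ring

lemma norm_cosh_mul_ofReal_le_one {μ : ℂ} (hμ : μ.re = 0) (t : ℝ) :
    ‖Complex.cosh (μ * t)‖ ≤ 1 := by
  have h1 : ‖Complex.exp (μ * t)‖ = 1 := by simp [Complex.norm_exp, hμ]
  have h2 : ‖Complex.exp (-(μ * t))‖ = 1 := by simp [Complex.norm_exp, hμ]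
  rw [Complex.cosh, norm_div, Complex.norm_ofNat]
  linarith [norm_add_le (Complex.exp (μ * t)) (Complex.exp (-(μ * t)))]

lemma le_cosh (t : ℝ) : t ≤ Real.cosh t := by
  rcases le_or_gt t 0 with h | h
  · exact h.trans (Real.cosh_pos t).le
  · rw [Real.cosh_eq]
    nlinarith [Real.quadratic_le_exp_of_nonneg h.le, Real.exp_pos (-t), sq_nonneg (t - 1)]

lemma le_log_two_mul_cosh (t : ℝ) : t ≤ Real.log (2 * Real.cosh t) := by
  rw [Real.le_log_iff_exp_le (by have := Real.cosh_pos t; positivity), Real.cosh_eq]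
  linarith [Real.exp_pos (-t)]

lemma continuousAt_besselK {μ : ℂ} (hμ : μ.re = 0) {x : ℝ} (hx : 0 < x) :
    ContinuousAt (besselK μ) x := by
  refine continuousAt_of_dominated (bound := fun t => Real.exp (-(x / 2) * t))
    (.of_forall fun y => ?_) ?_ (exp_neg_integrableOn_Ioi 0 (half_pos hx))
    (.of_forall fun t => ?_)
  · exact Continuous.aestronglyMeasurable (by fun_prop)
  · filter_upwards [lt_mem_nhds (half_lt_self hx)] with y hy
    filter_upwards [ae_restrict_mem measurableSet_Ioi] with t ht
    rw [norm_mul, ← mul_one (Real.exp _)]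
    refine mul_le_mul ?_ (norm_cosh_mul_ofReal_le_one hμ t) (norm_nonneg _) (Real.exp_pos _).le
    rw [← Complex.ofReal_neg, ← Complex.ofReal_mul, Complex.norm_exp_ofReal, Real.exp_le_exp]
    have := le_cosh t
    have ht := mem_Ioi.1 ht
    nlinarith
  · fun_prop

lemma integrable_besselK_mellin_kernel {s μ : ℂ} (hs : 0 < s.re) (hμ : μ.re = 0) :
    Integrable (Function.uncurry fun x t : ℝ => (x : ℂ) ^ (s - 1)
        * (Complex.exp (-((2 * x : ℝ) : ℂ) * Real.cosh t) * Complex.cosh (μ * t)))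
      ((volume.restrict (Ioi 0)).prod (volume.restrict (Ioi 0))) := by
  have hmeas : Measurable (Function.uncurry fun x t : ℝ => (x : ℂ) ^ (s - 1)
      * (Complex.exp (-((2 * x : ℝ) : ℂ) * Real.cosh t) * Complex.cosh (μ * t))) := by
    unfold Function.uncurry
    refine Measurable.mul (by fun_prop) (Continuous.measurable (by fun_prop))
  have hnorm : ∀ {x : ℝ}, 0 < x → ∀ t : ℝ, ‖(x : ℂ) ^ (s - 1)
      * (Complex.exp (-((2 * x : ℝ) : ℂ) * Real.cosh t) * Complex.cosh (μ * t))‖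
      = x ^ (s.re - 1) * Real.exp (-((2 * Real.cosh t) * x)) * ‖Complex.cosh (μ * t)‖ := by
    intro x hx t
    rw [norm_mul, norm_mul, Complex.norm_cpow_eq_rpow_re_of_pos hx, ← Complex.ofReal_neg,
      ← Complex.ofReal_mul, Complex.norm_exp_ofReal, mul_assoc, Complex.sub_re, Complex.one_re]
    congr 3
    ring_nf
  have hint : ∀ t : ℝ, IntegrableOn
      (fun x : ℝ => x ^ (s.re - 1) * Real.exp (-((2 * Real.cosh t) * x))) (Ioi 0) := fun t => by
    simpa [neg_mul] using integrableOn_rpow_mul_exp_neg_mul_rpow (p := 1) (s := s.re - 1)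
      (b := 2 * Real.cosh t) (by linarith) one_pos (mul_pos two_pos (Real.cosh_pos t))
  rw [integrable_prod_iff' hmeas.aestronglyMeasurable]
  constructor
  · refine .of_forall fun t => ?_
    refine ((hint t).mul_const ‖Complex.cosh (μ * t)‖).mono'
      (hmeas.comp measurable_prodMk_right).aestronglyMeasurable ?_
    filter_upwards [ae_restrict_mem measurableSet_Ioi] with x hx
    exact (hnorm hx t).le
  · refine ((exp_neg_integrableOn_Ioi 0 hs).mul_const (Real.Gamma s.re)).mono'
      hmeas.norm.stronglyMeasurable.integral_prod_left'.aestronglyMeasurable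
      (.of_forall fun t => ?_)
    rw [Real.norm_of_nonneg (integral_nonneg fun _ => norm_nonneg _)]
    have hc := mul_pos two_pos (Real.cosh_pos t)
    have : ∫ x in Ioi (0 : ℝ), ‖Function.uncurry (fun x t : ℝ => (x : ℂ) ^ (s - 1)
        * (Complex.exp (-((2 * x : ℝ) : ℂ) * Real.cosh t) * Complex.cosh (μ * t))) (x, t)‖
        = (1 / (2 * Real.cosh t)) ^ s.re * Real.Gamma s.re * ‖Complex.cosh (μ * t)‖ := by
      rw [← Real.integral_rpow_mul_exp_neg_mul_Ioi hs hc, ← integral_mul_const]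
      exact setIntegral_congr_fun measurableSet_Ioi fun x hx => hnorm hx t
    rw [this]
    have hG := Real.Gamma_pos_of_pos hs
    have hpow : (1 / (2 * Real.cosh t)) ^ s.re ≤ Real.exp (-s.re * t) := by
      rw [Real.rpow_def_of_pos (by positivity), Real.exp_le_exp, one_div, Real.log_inv]
      have := le_log_two_mul_cosh t
      nlinarith
    calc _ ≤ Real.exp (-s.re * t) * Real.Gamma s.re * 1 := by
          gcongr
          exact norm_cosh_mul_ofReal_le_one hμ t
      _ = _ := mul_one _

/-- The Mellin transform of `x ↦ K_μ(2x)`. -/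
lemma hasMellin_besselK_s6 {s μ : ℂ} (hs : 0 < s.re) (hμ : μ.re = 0) :
    HasMellin (fun x => besselK μ (2 * x)) s
      (4⁻¹ * (Complex.Gamma ((s + μ) / 2) * Complex.Gamma ((s - μ) / 2))) := by
  have hF := integrable_besselK_mellin_kernel hs hμ
  have hval : ∀ x : ℝ, (x : ℂ) ^ (s - 1) • besselK μ (2 * x) = ∫ t in Ioi (0 : ℝ),
      (x : ℂ) ^ (s - 1)
        * (Complex.exp (-((2 * x : ℝ) : ℂ) * Real.cosh t) * Complex.cosh (μ * t)) := fun x => by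
    rw [integral_const_mul, besselK, smul_eq_mul]
  refine ⟨?_, ?_⟩
  · simp only [MellinConvergent, hval]
    exact hF.integral_prod_left
  · simp only [mellin, hval]
    rw [integral_integral_swap hF]
    have hinner : ∀ t : ℝ, ∫ x in Ioi (0 : ℝ), (x : ℂ) ^ (s - 1)
        * (Complex.exp (-((2 * x : ℝ) : ℂ) * Real.cosh t) * Complex.cosh (μ * t))
        = Complex.Gamma s * (Complex.cosh (μ * t) * ((2 * Real.cosh t : ℝ) : ℂ) ^ (-s)) := by
      intro t
      have hc := mul_pos two_pos (Real.cosh_pos t)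
      have h := Complex.integral_cpow_mul_exp_neg_mul_Ioi hs hc
      have hpow : (1 / ((2 * Real.cosh t : ℝ) : ℂ)) ^ s = ((2 * Real.cosh t : ℝ) : ℂ) ^ (-s) := by
        rw [← Complex.ofReal_one, ← Complex.ofReal_div, ofReal_cpow_eq_exp (by positivity),
          ofReal_cpow_eq_exp hc, one_div, Real.log_inv]
        push_cast
        ring_nf
      rw [hpow] at h
      calc _ = ∫ x in Ioi (0 : ℝ), (x : ℂ) ^ (s - 1)
            * Complex.exp (-(((2 * Real.cosh t : ℝ) : ℂ) * x)) * Complex.cosh (μ * t) := by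
            congr 1 with x
            rw [mul_assoc]
            congr 3
            push_cast
            ring
        _ = _ := by
            rw [integral_mul_const, h]
            ring
    simp only [hinner]
    rw [integral_const_mul, integral_cosh_mul_two_cosh_cpow (by simpa [hμ]) (by simpa [hμ])]
    have := Complex.Gamma_ne_zero_of_re_pos hs
    field_simp

/-- The inverse Mellin representation of `x ↦ K_μ(2x)`, on a shifted vertical line. -/
lemma integral_Gamma_mul_Gamma_mul_cpow {σ : ℝ} (hσ : 0 < σ) {μ ν : ℂ} (hμ : μ.re = 0)
    (hν : ν.re = 0) {x : ℝ} (hx : 0 < x) :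
    ∫ t : ℝ, Complex.Gamma ((σ + t * Complex.I + (ν + μ)) / 2)
        * Complex.Gamma ((σ + t * Complex.I + (ν - μ)) / 2) * (x : ℂ) ^ (-(σ + t * Complex.I))
      = 8 * π * ((x : ℂ) ^ ν * besselK μ (2 * x)) := by
  set f : ℝ → ℂ := fun x => (x : ℂ) ^ ν • besselK μ (2 * x) with hf
  have hmellin : ∀ t : ℝ, HasMellin f (σ + t * Complex.I)
      (4⁻¹ * (Complex.Gamma ((σ + t * Complex.I + (ν + μ)) / 2)
        * Complex.Gamma ((σ + t * Complex.I + (ν - μ)) / 2))) := fun t => by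
    have h := hasMellin_besselK_s6 (s := σ + t * Complex.I + ν) (by simpa [hν]) hμ
    refine ⟨MellinConvergent.cpow_smul.2 h.1, ?_⟩
    rw [hf, mellin_cpow_smul, h.2, add_assoc, add_sub_assoc, add_assoc]
  have hconv : MellinConvergent f σ := by simpa using (hmellin 0).1
  have hvert : Complex.VerticalIntegrable (mellin f) σ := by
    simp only [Complex.VerticalIntegrable, (hmellin _).2]
    exact (integrable_Gamma_mul_Gamma_vertical hσ (by simp [hμ, hν])
      (by simp [hμ, hν])).const_mul _
  have hcont : ContinuousAt f x :=
    (Complex.continuousAt_ofReal_cpow_const _ _ (Or.inr hx.ne')).mul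
      ((continuousAt_besselK hμ (by positivity : 0 < 2 * x)).comp (f := fun x : ℝ => 2 * x)
        (by fun_prop))
  have h := mellinInv_mellin_eq σ f hx hconv hvert hcont
  simp only [mellinInv, (hmellin _).2] at h
  rw [← smul_eq_mul ((x : ℂ) ^ ν)]
  change _ = _ * f x
  rw [← h, Complex.real_smul, ← mul_assoc, ← integral_const_mul]
  congr 1 with t
  have hpi : (π : ℂ) ≠ 0 := by exact_mod_cast Real.pi_ne_zero
  push_cast
  rw [smul_eq_mul]
  field_simp
  ring

/-- The integrand of the Barnes-type integral, with a ratio of Gamma functions expanded as a Beta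
integral in the first variable. -/
noncomputable def barnesKernel (α β γ : ℂ) (σ₁ σ₂ x₁ x₂ : ℝ) (p : ℝ × ℝ × ℝ) : ℂ :=
  (Complex.Gamma ((σ₁ + p.2.1 * Complex.I + α) / 2)
      * Complex.Gamma ((σ₁ + p.2.1 * Complex.I + β) / 2))
    * (Complex.Gamma ((σ₂ + p.2.2 * Complex.I + -α) / 2)
      * Complex.Gamma ((σ₂ + p.2.2 * Complex.I + -β) / 2))
    * ((x₁ : ℂ) ^ (1 - (σ₁ + p.2.1 * Complex.I)) * (x₂ : ℂ) ^ (1 - (σ₂ + p.2.2 * Complex.I)))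
    * ((p.1 : ℂ) ^ ((σ₂ + p.2.2 * Complex.I - γ) / 2 - 1)
      * ((1 + p.1 : ℝ) : ℂ) ^ (-((σ₂ + p.2.2 * Complex.I - γ) / 2
        + (σ₁ + p.2.1 * Complex.I + γ) / 2)))

lemma integrable_barnesKernel {α β γ : ℂ} (hα : α.re = 0) (hβ : β.re = 0) (hγ : γ.re = 0)
    {σ₁ σ₂ : ℝ} (hσ₁ : 0 < σ₁) (hσ₂ : 0 < σ₂) {x₁ x₂ : ℝ} (hx₁ : 0 < x₁) (hx₂ : 0 < x₂) :
    Integrable (barnesKernel α β γ σ₁ σ₂ x₁ x₂) ((volume.restrict (Ioi 0)).prod volume) := by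
  have h₁ := integrable_Gamma_mul_Gamma_vertical hσ₁ hα hβ
  have h₂ := integrable_Gamma_mul_Gamma_vertical hσ₂ (a := -α) (b := -β) (by simpa) (by simpa)
  have hbeta : Integrable (fun u : ℝ => u ^ (σ₂ / 2 - 1) * (1 + u) ^ (-(σ₂ / 2 + σ₁ / 2)))
      (volume.restrict (Ioi 0)) := by
    have h := (hasMellin_one_add_cpow (a := (σ₂ / 2 : ℝ)) (b := (σ₁ / 2 : ℝ))
      (by simpa) (by simpa)).1.norm
    refine h.congr ?_
    filter_upwards [ae_restrict_mem measurableSet_Ioi] with u hu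
    have hu := mem_Ioi.1 hu
    rw [norm_smul, Complex.norm_cpow_eq_rpow_re_of_pos hu,
      Complex.norm_cpow_eq_rpow_re_of_pos (by linarith)]
    simp
  have hG := h₁.mul_prod h₂
  refine (hbeta.mul_prod (hG.norm.const_mul (x₁ ^ (1 - σ₁) * x₂ ^ (1 - σ₂)))).mono' ?_ ?_
  · refine AEStronglyMeasurable.mul (AEStronglyMeasurable.mul
      hG.aestronglyMeasurable.comp_snd ?_) ?_ <;>
    exact Measurable.aestronglyMeasurable (by fun_prop)
  · have hpos : ∀ᵐ p : ℝ × ℝ × ℝ ∂(volume.restrict (Ioi 0)).prod volume, 0 < p.1 :=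
      Measure.quasiMeasurePreserving_fst.ae (ae_restrict_mem measurableSet_Ioi)
    filter_upwards [hpos] with p hp
    refine le_of_eq ?_
    rw [barnesKernel, norm_mul, norm_mul, norm_mul (_ ^ _), norm_mul (_ ^ _),
      Complex.norm_cpow_eq_rpow_re_of_pos hp, Complex.norm_cpow_eq_rpow_re_of_pos hx₁,
      Complex.norm_cpow_eq_rpow_re_of_pos hx₂, Complex.norm_cpow_eq_rpow_re_of_pos (by linarith)]
    have e₁ : ((σ₂ + p.2.2 * Complex.I - γ) / 2 - 1).re = σ₂ / 2 - 1 := by simp [hγ]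
    have e₂ : (-((σ₂ + p.2.2 * Complex.I - γ) / 2 + (σ₁ + p.2.1 * Complex.I + γ) / 2)).re
        = -(σ₂ / 2 + σ₁ / 2) := by simp [hγ]
    have e₃ : ∀ σ t : ℝ, (1 - (σ + t * Complex.I)).re = 1 - σ := fun σ t => by simp
    rw [e₁, e₂, e₃, e₃]
    ring

lemma setIntegral_barnesKernel {α β γ : ℂ} (hγ : γ.re = 0) {σ₁ σ₂ : ℝ} (hσ₁ : 0 < σ₁)
    (hσ₂ : 0 < σ₂) (x₁ x₂ : ℝ) (t : ℝ × ℝ) :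
    ∫ u in Ioi (0 : ℝ), barnesKernel α β γ σ₁ σ₂ x₁ x₂ (u, t)
      = Complex.Gamma (((σ₂ : ℂ) + Complex.I * t.2 - α) / 2)
        * Complex.Gamma (((σ₂ : ℂ) + Complex.I * t.2 - β) / 2)
        * Complex.Gamma (((σ₂ : ℂ) + Complex.I * t.2 - γ) / 2)
        * Complex.Gamma (((σ₁ : ℂ) + Complex.I * t.1 + α) / 2)
        * Complex.Gamma (((σ₁ : ℂ) + Complex.I * t.1 + β) / 2)
        * Complex.Gamma (((σ₁ : ℂ) + Complex.I * t.1 + γ) / 2)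
        / Complex.Gamma (((σ₁ : ℂ) + Complex.I * t.1 + (σ₂ : ℂ) + Complex.I * t.2) / 2)
        * (x₁ : ℂ) ^ ((1 : ℂ) - σ₁ - Complex.I * t.1)
        * (x₂ : ℂ) ^ ((1 : ℂ) - σ₂ - Complex.I * t.2) := by
  have h := (hasMellin_one_add_cpow (a := (σ₂ + t.2 * Complex.I - γ) / 2)
    (b := (σ₁ + t.1 * Complex.I + γ) / 2) (by simpa [hγ]) (by simpa [hγ])).2
  have hsum : (σ₂ + t.2 * Complex.I - γ) / 2 + (σ₁ + t.1 * Complex.I + γ) / 2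
      = ((σ₁ : ℂ) + t.1 * Complex.I + (σ₂ : ℂ) + t.2 * Complex.I) / 2 := by ring
  simp only [mellin, smul_eq_mul] at h
  simp only [barnesKernel]
  rw [integral_const_mul, h, hsum]
  simp only [mul_comm Complex.I, ← sub_eq_add_neg, sub_sub]
  ring

lemma integral_barnesKernel {α β γ : ℂ} (hsum : α + β + γ = 0) (hα : α.re = 0) (hβ : β.re = 0)
    (hγ : γ.re = 0) {σ₁ σ₂ : ℝ} (hσ₁ : 0 < σ₁) (hσ₂ : 0 < σ₂) {x₁ x₂ : ℝ} (hx₁ : 0 < x₁)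
    (hx₂ : 0 < x₂) {u : ℝ} (hu : 0 < u) :
    ∫ t : ℝ × ℝ, barnesKernel α β γ σ₁ σ₂ x₁ x₂ (u, t)
      = 64 * π ^ 2 * ((x₁ : ℂ) ^ (1 - γ / 2) * (x₂ : ℂ) ^ (1 + γ / 2)
        * (besselK ((α - β) / 2) (2 * (x₁ * √(1 + u)))
          * besselK ((α - β) / 2) (2 * (x₂ * √(1 + u⁻¹)))
          * (u : ℂ) ^ (-(3 * γ) / 4 - 1))) := by
  have h1u : 0 < 1 + u := by linarith
  have hinv : 1 + u⁻¹ = (1 + u) / u := by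
    field_simp
    ring
  have hz₁ : 0 < x₁ * √(1 + u) := by positivity
  have hz₂ : 0 < x₂ * √(1 + u⁻¹) := by positivity
  have hγ' : γ = -α - β := by linear_combination hsum
  have hμ : ((α - β) / 2).re = 0 := by simp [hα, hβ]
  have hlog₁ : Real.log (x₁ * √(1 + u)) = Real.log x₁ + Real.log (1 + u) / 2 := by
    rw [Real.log_mul hx₁.ne' (by positivity), Real.log_sqrt h1u.le]
  have hlog₂ : Real.log (x₂ * √(1 + u⁻¹))
      = Real.log x₂ + (Real.log (1 + u) - Real.log u) / 2 := by
    rw [Real.log_mul hx₂.ne' (by positivity), Real.log_sqrt (by positivity), hinv,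
      Real.log_div h1u.ne' hu.ne']
  have k₁ := integral_Gamma_mul_Gamma_mul_cpow hσ₁ (ν := -γ / 2) hμ (by simp [hγ]) hz₁
  have k₂ := integral_Gamma_mul_Gamma_mul_cpow hσ₂ (ν := γ / 2) hμ (by simp [hγ]) hz₂
  rw [show -γ / 2 + (α - β) / 2 = α by rw [hγ']; ring,
    show -γ / 2 - (α - β) / 2 = β by rw [hγ']; ring] at k₁
  rw [show γ / 2 + (α - β) / 2 = -β by rw [hγ']; ring,
    show γ / 2 - (α - β) / 2 = -α by rw [hγ']; ring] at k₂
  have hpow : ∀ s₁ s₂ : ℂ, (x₁ : ℂ) ^ (1 - s₁) * (x₂ : ℂ) ^ (1 - s₂)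
      * ((u : ℂ) ^ ((s₂ - γ) / 2 - 1) * ((1 + u : ℝ) : ℂ) ^ (-((s₂ - γ) / 2 + (s₁ + γ) / 2)))
      = (x₁ : ℂ) * x₂ * (u : ℂ) ^ (-γ / 2 - 1)
        * (((x₁ * √(1 + u) : ℝ) : ℂ) ^ (-s₁) * ((x₂ * √(1 + u⁻¹) : ℝ) : ℂ) ^ (-s₂)) := by
    intro s₁ s₂
    have hx₁' : (x₁ : ℂ) = _ := ofReal_eq_exp_log hx₁
    have hx₂' : (x₂ : ℂ) = _ := ofReal_eq_exp_log hx₂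
    simp only [ofReal_cpow_eq_exp hx₁, ofReal_cpow_eq_exp hx₂, ofReal_cpow_eq_exp hu,
      ofReal_cpow_eq_exp h1u, ofReal_cpow_eq_exp hz₁, ofReal_cpow_eq_exp hz₂, hlog₁, hlog₂]
    generalize Real.log x₁ = l₁ at *
    generalize Real.log x₂ = l₂ at *
    rw [hx₁', hx₂']
    simp only [← Complex.exp_add]
    congr 1
    push_cast
    ring
  have hpow' : (x₁ : ℂ) * x₂ * (u : ℂ) ^ (-γ / 2 - 1)
      * (((x₁ * √(1 + u) : ℝ) : ℂ) ^ (-γ / 2) * ((x₂ * √(1 + u⁻¹) : ℝ) : ℂ) ^ (γ / 2))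
      = (x₁ : ℂ) ^ (1 - γ / 2) * (x₂ : ℂ) ^ (1 + γ / 2) * (u : ℂ) ^ (-(3 * γ) / 4 - 1) := by
    have hx₁' : (x₁ : ℂ) = _ := ofReal_eq_exp_log hx₁
    have hx₂' : (x₂ : ℂ) = _ := ofReal_eq_exp_log hx₂
    simp only [ofReal_cpow_eq_exp hx₁, ofReal_cpow_eq_exp hx₂, ofReal_cpow_eq_exp hu,
      ofReal_cpow_eq_exp hz₁, ofReal_cpow_eq_exp hz₂, hlog₁, hlog₂]
    generalize Real.log x₁ = l₁ at *
    generalize Real.log x₂ = l₂ at *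
    rw [hx₁', hx₂']
    simp only [← Complex.exp_add]
    congr 1
    push_cast
    ring
  set A : ℝ → ℂ := fun t => Complex.Gamma ((σ₁ + t * Complex.I + α) / 2)
    * Complex.Gamma ((σ₁ + t * Complex.I + β) / 2)
    * ((x₁ * √(1 + u) : ℝ) : ℂ) ^ (-(σ₁ + t * Complex.I)) with hA
  set B : ℝ → ℂ := fun t => Complex.Gamma ((σ₂ + t * Complex.I + -β) / 2)
    * Complex.Gamma ((σ₂ + t * Complex.I + -α) / 2)
    * ((x₂ * √(1 + u⁻¹) : ℝ) : ℂ) ^ (-(σ₂ + t * Complex.I)) with hB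
  have hsplit : ∀ t : ℝ × ℝ, barnesKernel α β γ σ₁ σ₂ x₁ x₂ (u, t)
      = (x₁ : ℂ) * x₂ * (u : ℂ) ^ (-γ / 2 - 1) * (A t.1 * B t.2) := fun t => by
    rw [barnesKernel, mul_assoc (_ * _), hpow, hA, hB]
    ring
  simp only [hsplit]
  rw [integral_const_mul, Measure.volume_eq_prod, integral_prod_mul, k₁, k₂]
  linear_combination (64 * π ^ 2 * (besselK ((α - β) / 2) (2 * (x₁ * √(1 + u)))
    * besselK ((α - β) / 2) (2 * (x₂ * √(1 + u⁻¹))))) * hpow'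

/-- Jacquet's Whittaker function admits an absolutely convergent double inverse Mellin
(Barnes-type) representation along vertical lines `Re s₁ = σ₁ > 0`, `Re s₂ = σ₂ > 0`. -/
theorem jacquetW_inverse_mellin (α β γ : ℂ) (hsum : α + β + γ = 0)
    (hα : α.re = 0) (hβ : β.re = 0) (hγ : γ.re = 0)
    (σ₁ σ₂ : ℝ) (hσ₁ : 0 < σ₁) (hσ₂ : 0 < σ₂) (y₁ y₂ : ℝ) (hy₁ : 0 < y₁) (hy₂ : 0 < y₂) :
    Integrable (fun t : ℝ × ℝ =>
      Complex.Gamma (((σ₂ : ℂ) + Complex.I * t.2 - α) / 2)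
      * Complex.Gamma (((σ₂ : ℂ) + Complex.I * t.2 - β) / 2)
      * Complex.Gamma (((σ₂ : ℂ) + Complex.I * t.2 - γ) / 2)
      * Complex.Gamma (((σ₁ : ℂ) + Complex.I * t.1 + α) / 2)
      * Complex.Gamma (((σ₁ : ℂ) + Complex.I * t.1 + β) / 2)
      * Complex.Gamma (((σ₁ : ℂ) + Complex.I * t.1 + γ) / 2)
      / Complex.Gamma (((σ₁ : ℂ) + Complex.I * t.1 + (σ₂ : ℂ) + Complex.I * t.2) / 2)
      * ((π * y₁ : ℝ) : ℂ) ^ ((1 : ℂ) - σ₁ - Complex.I * t.1)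
      * ((π * y₂ : ℝ) : ℂ) ^ ((1 : ℂ) - σ₂ - Complex.I * t.2)) ∧
    jacquetW α β γ y₁ y₂
      = (1 / (4 * π ^ 2)) * ∫ t : ℝ × ℝ,
          Complex.Gamma (((σ₂ : ℂ) + Complex.I * t.2 - α) / 2)
          * Complex.Gamma (((σ₂ : ℂ) + Complex.I * t.2 - β) / 2)
          * Complex.Gamma (((σ₂ : ℂ) + Complex.I * t.2 - γ) / 2)
          * Complex.Gamma (((σ₁ : ℂ) + Complex.I * t.1 + α) / 2)
          * Complex.Gamma (((σ₁ : ℂ) + Complex.I * t.1 + β) / 2)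
          * Complex.Gamma (((σ₁ : ℂ) + Complex.I * t.1 + γ) / 2)
          / Complex.Gamma (((σ₁ : ℂ) + Complex.I * t.1 + (σ₂ : ℂ) + Complex.I * t.2) / 2)
          * ((π * y₁ : ℝ) : ℂ) ^ ((1 : ℂ) - σ₁ - Complex.I * t.1)
          * ((π * y₂ : ℝ) : ℂ) ^ ((1 : ℂ) - σ₂ - Complex.I * t.2) := by
  have hπ₁ : 0 < π * y₁ := mul_pos Real.pi_pos hy₁
  have hπ₂ : 0 < π * y₂ := mul_pos Real.pi_pos hy₂
  have hint : Integrable (barnesKernel α β γ σ₁ σ₂ (π * y₁) (π * y₂))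
      ((volume.restrict (Ioi 0)).prod volume) :=
    integrable_barnesKernel hα hβ hγ hσ₁ hσ₂ hπ₁ hπ₂
  simp only [← setIntegral_barnesKernel (α := α) (β := β) hγ hσ₁ hσ₂ (π * y₁) (π * y₂)]
  refine ⟨hint.integral_prod_right, ?_⟩
  rw [integral_integral_swap
      (f := fun t u => barnesKernel α β γ σ₁ σ₂ (π * y₁) (π * y₂) (u, t)) hint.swap,
    ← integral_const_mul, jacquetW, ← integral_const_mul]
  refine setIntegral_congr_fun measurableSet_Ioi fun u hu => ?_
  rw [integral_barnesKernel hsum hα hβ hγ hσ₁ hσ₂ hπ₁ hπ₂ hu]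
  have hpi : (π : ℂ) ≠ 0 := by exact_mod_cast Real.pi_ne_zero
  simp only [mul_assoc]
  field_simp
  ring
end
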